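/- arXiv:2106.13910 — 2 statements merged into one kernel-verified Lean document; each statement's English description precedes it below -/
import Mathlib

section
/- The covering radius of RM(2,6) in RM(3,6) equals 18; that is, every Boolean function on 6 variables of degree at most 3 has distance at most 18 to RM(2,6), and some Boolean function on 6 variables of degree at most 3 has distance exactly 18 to RM(2,6). -/
open MvPolynomial

/-- A Boolean function on `m` variables over 𝔽₂. -/
abbrev BF (m : ℕ) := (Fin m → ZMod 2) → ZMod 2

/-- The unique multilinear polynomial over 𝔽₂ representing the Boolean function `f`
(obtained by interpolation: `∏ i (Xᵢ + vᵢ + 1)` is the indicator of the input `v`). -/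
noncomputable def repPoly {m : ℕ} (f : BF m) : MvPolynomial (Fin m) (ZMod 2) :=
  ∑ v : Fin m → ZMod 2, f v • ∏ i : Fin m, (X i + C (v i + 1))

/-- The degree of a Boolean function: the total degree of its multilinear representative. -/
noncomputable def deg {m : ℕ} (f : BF m) : ℕ := (repPoly f).totalDegree

/-- The weight of a Boolean function: the number of inputs on which it takes the value 1. -/
noncomputable def wt {m : ℕ} (f : BF m) : ℕ :=
  (Finset.univ.filter fun v => f v = 1).card

/-- The distance from `f` to the Reed–Muller code `RM(r,m)`: the minimum weight of
`f + p` over Boolean functions `p` of degree at most `r`. -/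
noncomputable def distRM (m r : ℕ) (f : BF m) : ℕ :=
  sInf {w | ∃ p : BF m, deg p ≤ r ∧ wt (f + p) = w}

/-- The coefficient of `∏ i ∈ S, Xᵢ` in the Boolean polynomial of `f`. -/
def anfCoeff {m : ℕ} (f : BF m) (S : Finset (Fin m)) : ZMod 2 :=
  ∑ v : Fin m → ZMod 2, f v * ∏ i : Fin m, if i ∈ S then 1 else 1 + v i

lemma prod_add_const_eq_sum {m : ℕ} {R : Type*} [CommRing R] (x y : Fin m → R) :
    ∏ i, (x i + y i) = ∑ S : Finset (Fin m), (∏ i, if i ∈ S then 1 else y i) * ∏ i ∈ S, x i := by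
  classical
  rw [Finset.prod_add, Finset.powerset_univ]
  refine Finset.sum_congr rfl fun S _ => ?_
  rw [mul_comm, Finset.prod_ite, Finset.prod_const_one, one_mul]
  congr 1
  refine Finset.prod_congr ?_ fun _ _ => rfl
  ext i; simp

lemma repPoly_eq_sum {m : ℕ} (f : BF m) :
    repPoly f = ∑ S : Finset (Fin m), C (anfCoeff f S) * ∏ i ∈ S, X i := by
  simp only [repPoly, anfCoeff, prod_add_const_eq_sum, map_sum, map_mul, map_prod, Finset.smul_sum,
    Finset.sum_mul]
  rw [Finset.sum_comm]
  refine Finset.sum_congr rfl fun S _ => Finset.sum_congr rfl fun v _ => ?_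
  rw [MvPolynomial.smul_eq_C_mul, mul_assoc]
  congr 3 with i
  split_ifs <;> simp [add_comm]

lemma ZMod.two_add_eq_ite (a b : ZMod 2) : a + (b + 1) = if b = a then 1 else 0 := by
  revert a b; decide

lemma eq_sum_anfCoeff {m : ℕ} (f : BF m) (x : Fin m → ZMod 2) :
    f x = ∑ S : Finset (Fin m), anfCoeff f S * ∏ i ∈ S, x i := by
  have h : f x = ∑ v : Fin m → ZMod 2, f v * ∏ i, (x i + (v i + 1)) := by
    rw [Finset.sum_eq_single x]
    · simp [ZMod.two_add_eq_ite]
    · intro v _ hv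
      obtain ⟨i, hi⟩ := Function.ne_iff.mp hv
      rw [Finset.prod_eq_zero (Finset.mem_univ i), mul_zero]
      rw [ZMod.two_add_eq_ite, if_neg hi]
    · simp
  simp only [h, anfCoeff, prod_add_const_eq_sum, Finset.mul_sum, Finset.sum_mul]
  rw [Finset.sum_comm]
  refine Finset.sum_congr rfl fun S _ => Finset.sum_congr rfl fun v _ => ?_
  simp only [add_comm (v _) 1, mul_assoc]

lemma deg_le_iff {m : ℕ} (f : BF m) (r : ℕ) :
    deg f ≤ r ↔ ∀ S : Finset (Fin m), r < S.card → anfCoeff f S = 0 := by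
  classical
  have hX : ∀ S : Finset (Fin m), (∏ i ∈ S, X i : MvPolynomial (Fin m) (ZMod 2)) =
      monomial (∑ i ∈ S, Finsupp.single i 1) 1 := by
    intro S
    rw [MvPolynomial.monomial_sum_one]; rfl
  have he : ∀ S T : Finset (Fin m), (∑ i ∈ S, Finsupp.single i 1 : Fin m →₀ ℕ) =
      ∑ i ∈ T, Finsupp.single i 1 ↔ S = T := by
    refine fun S T => ⟨fun h => ?_, fun h => by rw [h]⟩
    ext i
    have := DFunLike.congr_fun h i
    simp only [Finsupp.finsetSum_apply, Finsupp.single_apply, Finset.sum_ite_eq'] at this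
    by_cases h1 : i ∈ S <;> by_cases h2 : i ∈ T <;> simp_all
  rw [deg, repPoly_eq_sum]
  constructor
  · intro h S hS
    have hc : coeff (∑ i ∈ S, Finsupp.single i 1) (∑ T : Finset (Fin m),
        C (anfCoeff f T) * ∏ i ∈ T, X i) = anfCoeff f S := by
      simp [hX, coeff_sum, coeff_C_mul, coeff_monomial, he]
    rw [← hc]
    apply MvPolynomial.coeff_eq_zero_of_totalDegree_lt
    refine h.trans_lt ?_
    have : (∑ i ∈ S, Finsupp.single i 1 : Fin m →₀ ℕ).degree = S.card := by simp
    rw [← this] at hS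
    exact hS
  · intro h
    refine MvPolynomial.totalDegree_finsetSum_le fun S _ => ?_
    by_cases hS : r < S.card
    · simp [h S hS]
    · refine (MvPolynomial.totalDegree_mul _ _).trans ?_
      rw [totalDegree_C, zero_add]
      refine (MvPolynomial.totalDegree_finsetProd _ _).trans ?_
      simpa using hS

lemma anfCoeff_add {m : ℕ} (f g : BF m) (S : Finset (Fin m)) :
    anfCoeff (f + g) S = anfCoeff f S + anfCoeff g S := by
  simp [anfCoeff, add_mul, Finset.sum_add_distrib]

lemma deg_add_le {m r : ℕ} {f g : BF m} (hf : deg f ≤ r) (hg : deg g ≤ r) : deg (f + g) ≤ r := by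
  rw [deg_le_iff] at *
  intro S hS
  rw [anfCoeff_add, hf S hS, hg S hS, add_zero]

lemma deg_zero_le {m : ℕ} (r : ℕ) : deg (0 : BF m) ≤ r := by
  simp [deg, repPoly]

lemma deg_sum_le {m r : ℕ} {ι : Type*} (s : Finset ι) {f : ι → BF m} (hf : ∀ i ∈ s, deg (f i) ≤ r) :
    deg (∑ i ∈ s, f i) ≤ r := by
  classical
  induction s using Finset.induction_on with
  | empty => simpa using deg_zero_le r
  | insert a s ha ih =>
    rw [Finset.sum_insert ha]
    exact deg_add_le (hf a (by simp)) (ih fun i hi => hf i (by simp [hi]))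

lemma sum_eq_zero_of_translate {m : ℕ} (f : BF m) (a : Fin m → ZMod 2)
    (h : ∀ v, f (v + a) = f v) (ha : a ≠ 0) : ∑ v, f v = 0 := by
  refine Finset.sum_involution (fun v _ => v + a) ?_ ?_ ?_ ?_
  · intro v _; rw [h]; exact CharTwo.add_self_eq_zero _
  · intro v _ _ hv; exact ha (by simpa using hv)
  · simp
  · intro v _
    ext i; simp [add_assoc, CharTwo.add_self_eq_zero]

lemma deg_mul_prod_le {m r : ℕ} (c : ZMod 2) (T : Finset (Fin m)) (hT : T.card ≤ r) :
    deg (fun v : Fin m → ZMod 2 => c * ∏ i ∈ T, v i) ≤ r := by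
  classical
  rw [deg_le_iff]
  intro S hS
  obtain ⟨j, hjS, hjT⟩ : ∃ j ∈ S, j ∉ T := by
    by_contra! h
    have := Finset.card_le_card (show S ⊆ T from h)
    omega
  refine sum_eq_zero_of_translate _ (Pi.single j 1) (fun v => ?_) (by simp)
  refine congrArg₂ _ (congrArg _ (Finset.prod_congr rfl fun i hi => ?_)) ?_
  · have : i ≠ j := fun h => hjT (h ▸ hi)
    simp [this]
  · refine Finset.prod_congr rfl fun i _ => ?_
    split_ifs with hi
    · rfl
    · have : i ≠ j := fun h => hi (h ▸ hjS)
      simp [this]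

lemma sum_eq_zero_of_deg_lt {m : ℕ} {f : BF m} (h : deg f < m) : ∑ v, f v = 0 := by
  have := (deg_le_iff f _).mp le_rfl Finset.univ (by simpa using h)
  simpa [anfCoeff] using this

/-- The restriction of `f` to the hyperplane where the first variable equals `b`. -/
def restrict {m : ℕ} (b : ZMod 2) (f : BF (m + 1)) : BF m := fun x => f (Fin.cons b x)

lemma sum_cons {m : ℕ} {M : Type*} [AddCommMonoid M] (F : (Fin (m + 1) → ZMod 2) → M) :
    ∑ v, F v = ∑ x : Fin m → ZMod 2, F (Fin.cons 0 x) + ∑ x : Fin m → ZMod 2, F (Fin.cons 1 x) := by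
  rw [← (Fin.consEquiv fun _ : Fin (m + 1) => ZMod 2).sum_comp, Fintype.sum_prod_type]
  exact Fin.sum_univ_two fun b : Fin 2 => ∑ x : Fin m → ZMod 2, F (Fin.cons (b : ZMod 2) x)

lemma anfCoeff_succ {m : ℕ} (f : BF (m + 1)) (S : Finset (Fin (m + 1))) :
    anfCoeff f S = anfCoeff (restrict 0 f) {i | i.succ ∈ S} +
      if 0 ∈ S then anfCoeff (restrict 1 f) {i | i.succ ∈ S} else 0 := by
  have h2 : (1 + 1 : ZMod 2) = 0 := by decide
  rw [anfCoeff, sum_cons]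
  split_ifs with h <;> simp [anfCoeff, restrict, Fin.prod_univ_succ, h, h2]

lemma card_succ {m : ℕ} (S : Finset (Fin (m + 1))) :
    S.card = (if 0 ∈ S then 1 else 0) + ({i | i.succ ∈ S} : Finset (Fin m)).card := by
  have := Fin.card_filter_univ_succ (fun i => i ∈ S)
  simp only [Finset.filter_univ_mem] at this
  rw [this]
  split_ifs <;> simp [add_comm]

lemma deg_succ_le_iff {m r : ℕ} (f : BF (m + 1)) :
    deg f ≤ r + 1 ↔ deg (restrict 0 f) ≤ r + 1 ∧ deg (restrict 0 f + restrict 1 f) ≤ r := by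
  classical
  simp only [deg_le_iff, anfCoeff_add]
  constructor
  · intro h
    constructor
    · intro S hS
      have h1 := h (S.map (Fin.succEmb m)) (by simpa using hS)
      simpa [anfCoeff_succ] using h1
    · intro S hS
      have h1 := h (insert 0 (S.map (Fin.succEmb m))) (by
        rw [Finset.card_insert_of_notMem (by simp)]; simpa using hS)
      simpa [anfCoeff_succ, Fin.succ_ne_zero] using h1
  · rintro ⟨h1, h2⟩ S hS
    rw [card_succ] at hS
    rw [anfCoeff_succ]
    split_ifs at hS ⊢ with h
    · exact h2 _ (by omega)
    · rw [add_zero]; exact h1 _ (by omega)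

lemma wt_eq_sum_val {m : ℕ} (f : BF m) : wt f = ∑ v, (f v).val := by
  rw [wt, Finset.card_filter]
  refine Finset.sum_congr rfl fun v _ => ?_
  generalize f v = z
  revert z; decide

lemma wt_succ {m : ℕ} (f : BF (m + 1)) : wt f = wt (restrict 0 f) + wt (restrict 1 f) := by
  simp only [wt_eq_sum_val, sum_cons, restrict]

lemma exists_join {m r : ℕ} (f : BF (m + 1)) {p l : BF m} (hp : deg p ≤ r + 1) (hl : deg l ≤ r) :
    ∃ q : BF (m + 1), deg q ≤ r + 1 ∧
      wt (f + q) = wt (restrict 0 f + p) + wt (restrict 1 f + p + l) := by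
  refine ⟨fun v => p (Fin.tail v) + v 0 * l (Fin.tail v), ?_, ?_⟩
  · rw [deg_succ_le_iff]
    constructor
    · convert hp using 2
      ext x
      simp [restrict]
    · have : ∀ a b : ZMod 2, a + (a + b) = b := by decide
      convert hl using 2
      ext x
      simp [restrict, this]
  · rw [wt_succ]
    congr 2 <;> ext x <;> simp [restrict, add_assoc]

/-- The sign `(-1) ^ z` of `z : 𝔽₂`. -/
def sgn (z : ZMod 2) : ℤ := 1 - 2 * z.val

lemma sgn_add (a b : ZMod 2) : sgn (a + b) = sgn a * sgn b := by revert a b; decide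

lemma sgn_le_one (a : ZMod 2) : sgn a ≤ 1 := by revert a; decide

lemma sum_sgn {m : ℕ} (f : BF m) : ∑ v, sgn (f v) = 2 ^ m - 2 * wt f := by
  simp [sgn, wt_eq_sum_val, Finset.sum_sub_distrib, Finset.mul_sum]

lemma even_wt {m : ℕ} {f : BF m} (h : ∑ v, f v = 0) : Even (wt f) := by
  rw [← ZMod.natCast_eq_zero_iff_even, wt_eq_sum_val]
  simpa using h

lemma sum_add_right_translate {m : ℕ} {M : Type*} [AddCommMonoid M] (F : (Fin m → ZMod 2) → M)
    (a : Fin m → ZMod 2) : ∑ v, F (v + a) = ∑ v, F v :=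
  Equiv.sum_comp (Equiv.addRight a) F

lemma sum_sgn_eq_zero {m : ℕ} (f : BF m) (a : Fin m → ZMod 2) (h : ∀ v, f (v + a) = f v + 1) :
    ∑ v, sgn (f v) = 0 := by
  have h1 := sum_add_right_translate (fun v => sgn (f v)) a
  have h2 : ∀ z : ZMod 2, sgn (z + 1) = - sgn z := by decide
  simp only [h, h2, Finset.sum_neg_distrib] at h1
  omega

/-- The linear function with coefficient vector `u`. -/
def linFun {m : ℕ} (u : Fin m → ZMod 2) : BF m := fun v => u ⬝ᵥ v

lemma sum_sgn_linFun {m : ℕ} (z : Fin m → ZMod 2) :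
    ∑ u, sgn (linFun u z) = if z = 0 then 2 ^ m else 0 := by
  split_ifs with hz
  · simp [hz, linFun, sgn]
  · obtain ⟨i, hi⟩ := Function.ne_iff.mp hz
    refine sum_sgn_eq_zero (fun u => linFun u z) (Pi.single i 1) fun v => ?_
    have : ∀ a : ZMod 2, a ≠ 0 → a = 1 := by decide
    simp [linFun, add_dotProduct, this _ hi]

lemma deg_const_le {m : ℕ} (r : ℕ) (c : ZMod 2) : deg (fun _ : Fin m → ZMod 2 => c) ≤ r := by
  simpa using deg_mul_prod_le (m := m) (r := r) c ∅ (by simp)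

lemma deg_linFun_le {m : ℕ} (u : Fin m → ZMod 2) : deg (linFun u) ≤ 1 := by
  have : linFun u = ∑ i, fun v => u i * ∏ j ∈ ({i} : Finset (Fin m)), v j := by
    ext v
    simp [linFun, dotProduct]
  rw [this]
  exact deg_sum_le _ fun i _ => deg_mul_prod_le _ _ (by simp)

lemma add_eq_zero_iff_eq_of_two {m : ℕ} (x y : Fin m → ZMod 2) : x + y = 0 ↔ x = y := by
  have : ∀ a b : ZMod 2, a + b = 0 ↔ a = b := by decide
  simp [funext_iff, this]

lemma parseval {m : ℕ} (f : BF m) :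
    ∑ u, (∑ v, sgn (f v + linFun u v)) ^ 2 = 2 ^ m * 2 ^ m := by
  have h1 : ∀ a : ZMod 2, sgn a * sgn a = 1 := by decide
  have h : ∀ u, (∑ v, sgn (f v + linFun u v)) ^ 2 =
      ∑ x, ∑ y, sgn (f x) * sgn (f y) * sgn (linFun u (x + y)) := by
    intro u
    rw [sq, Finset.sum_mul_sum]
    refine Finset.sum_congr rfl fun x _ => Finset.sum_congr rfl fun y _ => ?_
    simp only [linFun, dotProduct_add, sgn_add]
    ring
  simp only [h]
  rw [Finset.sum_comm]
  simp_rw [Finset.sum_comm (s := Finset.univ) (t := Finset.univ)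
    (f := fun u y => sgn (f _) * sgn (f y) * sgn (linFun u (_ + y))),
    ← Finset.mul_sum, sum_sgn_linFun, add_eq_zero_iff_eq_of_two]
  simp [h1]

lemma exists_two_pow_le_sq {m : ℕ} (f : BF m) :
    ∃ u, (2 : ℤ) ^ m ≤ (∑ v, sgn (f v + linFun u v)) ^ 2 := by
  by_contra! h
  have := Finset.sum_lt_sum_of_nonempty (Finset.univ_nonempty) fun u _ => h u
  rw [parseval] at this
  simp at this

lemma exists_two_pow_lt_sq {m : ℕ} (f : BF m) (u₀ : Fin m → ZMod 2)
    (h₀ : (∑ v, sgn (f v + linFun u₀ v)) ^ 2 ≠ 2 ^ m) :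
    ∃ u, (2 : ℤ) ^ m < (∑ v, sgn (f v + linFun u v)) ^ 2 := by
  by_contra! h
  have := Finset.sum_lt_sum (fun u _ => h u) ⟨u₀, Finset.mem_univ _, lt_of_le_of_ne (h u₀) h₀⟩
  rw [parseval] at this
  simp at this

/-- One of `f + ℓ` and `f + ℓ + 1`, with `ℓ` linear, has a nonnegative character sum. -/
lemma exists_affine_of_linFun {m : ℕ} (f : BF m) (u : Fin m → ZMod 2) :
    ∃ l : BF m, deg l ≤ 1 ∧ (2 ^ m - 2 * wt (f + l) : ℤ) = |∑ v, sgn (f v + linFun u v)| := by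
  rcases le_total 0 (∑ v, sgn (f v + linFun u v)) with h | h
  · refine ⟨linFun u, deg_linFun_le u, ?_⟩
    rw [abs_of_nonneg h, ← sum_sgn]
    rfl
  · refine ⟨linFun u + fun _ => 1, deg_add_le (deg_linFun_le u) (deg_const_le 1 1), ?_⟩
    have h2 : ∀ z : ZMod 2, sgn (z + 1) = - sgn z := by decide
    rw [abs_of_nonpos h, ← sum_sgn, ← Finset.sum_neg_distrib]
    simp only [← h2, Pi.add_apply, add_assoc]

lemma even_wt_add {m : ℕ} {f l : BF m} (hm : 1 < m) (hf : ∑ v, f v = 0) (hl : deg l ≤ 1) :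
    Even (wt (f + l)) :=
  even_wt (by simp [Finset.sum_add_distrib, hf, sum_eq_zero_of_deg_lt (hl.trans_lt hm)])

lemma exists_affine_wt_le_twelve {f : BF 5} (hf : ∑ v, f v = 0) :
    ∃ l : BF 5, deg l ≤ 1 ∧ wt (f + l) ≤ 12 := by
  obtain ⟨u, hu⟩ := exists_two_pow_le_sq f
  obtain ⟨l, hl, h⟩ := exists_affine_of_linFun f u
  refine ⟨l, hl, ?_⟩
  obtain ⟨k, hk⟩ := even_wt_add (by norm_num) hf hl
  rw [← sq_abs, ← h] at hu
  have := h ▸ abs_nonneg (∑ v, sgn (f v + linFun u v))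
  by_contra! hlt
  have : 14 ≤ (wt (f + l) : ℤ) := by omega
  nlinarith

lemma exists_affine_wt_le_six (f : BF 4) : ∃ l : BF 4, deg l ≤ 1 ∧ wt (f + l) ≤ 6 := by
  obtain ⟨u, hu⟩ := exists_two_pow_le_sq f
  obtain ⟨l, hl, h⟩ := exists_affine_of_linFun f u
  refine ⟨l, hl, ?_⟩
  rw [← sq_abs, ← h] at hu
  have := h ▸ abs_nonneg (∑ v, sgn (f v + linFun u v))
  by_contra! hlt
  have : 7 ≤ (wt (f + l) : ℤ) := by omega
  nlinarith

lemma anfCoeff_compl_singleton {f : BF 4} (hf : ∑ v, f v = 0) (i : Fin 4) :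
    anfCoeff f {i}ᶜ = ∑ v, f v * v i := by
  simp [anfCoeff, mul_add, Finset.sum_add_distrib, hf]

lemma eq_univ_or_compl_singleton (S : Finset (Fin 4)) (hS : 2 < S.card) :
    S = Finset.univ ∨ ∃ i, S = {i}ᶜ := by
  revert S; decide

lemma exists_sum_mul_ne_zero {f : BF 4} (hf : ∑ v, f v = 0) (h : ¬ deg f ≤ 2) :
    ∃ i, ∑ v, f v * v i ≠ 0 := by
  contrapose! h
  rw [deg_le_iff]
  intro S hS
  rcases eq_univ_or_compl_singleton S hS with rfl | ⟨i, rfl⟩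
  · simpa [anfCoeff] using hf
  · rw [anfCoeff_compl_singleton hf, h]

lemma exists_quadratic_wt_le_two {f : BF 4} (hf : ∑ v, f v = 0) (h : ¬ deg f ≤ 2) :
    ∃ p : BF 4, deg p ≤ 2 ∧ wt (f + p) ≤ 2 := by
  set c : Fin 4 → ZMod 2 := fun i => ∑ v, f v * v i with hc
  have hc0 : c ≠ 0 := by
    obtain ⟨i, hi⟩ := exists_sum_mul_ne_zero hf h
    exact Function.ne_iff.mpr ⟨i, hi⟩
  have h2 : ∀ z : ZMod 2, z + z = 0 := by decide
  let d : BF 4 := fun v => (if v = 0 then 1 else 0) + if v = c then 1 else 0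
  have hd : ∑ v, d v = 0 := by
    simp [d, Finset.sum_add_distrib, h2]
  have hfd : ∑ v, (f + d) v = 0 := by simp [Finset.sum_add_distrib, hf, hd]
  refine ⟨f + d, ?_, ?_⟩
  · by_contra hdeg
    obtain ⟨i, hi⟩ := exists_sum_mul_ne_zero hfd hdeg
    apply hi
    have hdi : ∑ v, d v * v i = c i := by simp [d, add_mul, Finset.sum_add_distrib]
    simp only [Pi.add_apply, add_mul, Finset.sum_add_distrib, hdi]
    exact h2 _
  · have : f + (f + d) = d := by ext v; simp [← add_assoc, h2]
    rw [this, wt]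
    refine (Finset.card_le_card (t := {0, c}) fun v hv => ?_).trans Finset.card_le_two
    by_contra hv'
    simp only [Finset.mem_insert, Finset.mem_singleton, not_or] at hv'
    simp [d, hv'.1, hv'.2] at hv

lemma wt_add {m : ℕ} (f g : BF m) : (wt (f + g) : ℤ) = wt f + wt g - 2 * wt (f * g) := by
  have h : ∀ a b : ZMod 2, ((a + b).val : ℤ) = a.val + b.val - 2 * (a * b).val := by decide
  simp [wt_eq_sum_val, h, Finset.sum_sub_distrib, Finset.sum_add_distrib, Finset.mul_sum]

lemma natCast_wt {m : ℕ} (f : BF m) : (wt f : ZMod 2) = ∑ v, f v := by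
  simp [wt_eq_sum_val]

lemma exists_affine_wt_le_four {f : BF 4} (hf : ∑ v, f v = 0) (h : ¬ deg f ≤ 2) :
    ∃ l : BF 4, deg l ≤ 1 ∧ wt (f + l) ≤ 4 := by
  obtain ⟨i, hi⟩ := exists_sum_mul_ne_zero hf h
  have hodd : Odd (wt (f * linFun (Pi.single i 1))) := by
    rw [← ZMod.natCast_ne_zero_iff_odd, natCast_wt]
    simpa [linFun] using hi
  have hlin : wt (linFun (Pi.single i (1 : ZMod 2))) = 8 := by
    have h0 := sum_sgn_eq_zero (linFun (Pi.single i (1 : ZMod 2))) (Pi.single i 1)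
      fun v => by simp [linFun]
    rw [sum_sgn] at h0
    omega
  obtain ⟨u₀, hu₀⟩ : ∃ u₀, (∑ v, sgn (f v + linFun u₀ v)) ^ 2 ≠ 2 ^ 4 := by
    by_contra! hall
    have h1 := hall 0
    have h2 := hall (Pi.single i 1)
    have e1 : ∑ v, sgn (f v + linFun 0 v) = 2 ^ 4 - 2 * wt f := by
      rw [← sum_sgn]; simp [linFun]
    have e2 : ∑ v, sgn (f v + linFun (Pi.single i 1) v) =
        2 ^ 4 - 2 * wt (f + linFun (Pi.single i 1)) := by
      rw [← sum_sgn]; rfl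
    rw [e1, show (2 : ℤ) ^ 4 = 4 ^ 2 by norm_num, sq_eq_sq_iff_eq_or_eq_neg] at h1
    rw [e2, wt_add, hlin, show (2 : ℤ) ^ 4 = 4 ^ 2 by norm_num, sq_eq_sq_iff_eq_or_eq_neg] at h2
    obtain ⟨k, hk⟩ := hodd
    obtain ⟨j, hj⟩ := even_wt hf
    omega
  obtain ⟨u, hu⟩ := exists_two_pow_lt_sq f u₀ hu₀
  obtain ⟨l, hl, h⟩ := exists_affine_of_linFun f u
  refine ⟨l, hl, ?_⟩
  obtain ⟨k, hk⟩ := even_wt_add (by norm_num) hf hl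
  rw [← sq_abs, ← h] at hu
  have := h ▸ abs_nonneg (∑ v, sgn (f v + linFun u v))
  by_contra! hlt
  have : 6 ≤ (wt (f + l) : ℤ) := by omega
  nlinarith

lemma deg_restrict_one_le {m r : ℕ} {f : BF (m + 1)} (hf : deg f ≤ r + 1) :
    deg (restrict 1 f) ≤ r + 1 := by
  obtain ⟨h0, h1⟩ := (deg_succ_le_iff f).mp hf
  have e : restrict 1 f = restrict 0 f + (restrict 0 f + restrict 1 f) := by
    ext v
    exact (CharTwo.add_cancel_left _ _).symm
  rw [e]
  exact deg_add_le h0 (h1.trans (Nat.le_succ r))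

lemma exists_quadratic_wt_le_six {f : BF 5} (hf : deg f ≤ 3) :
    ∃ p : BF 5, deg p ≤ 2 ∧ wt (f + p) ≤ 6 := by
  obtain ⟨h0, h1⟩ := (deg_succ_le_iff f).mp hf
  have hff : ∀ g : BF 4, g + g = 0 := fun g => by ext v; exact CharTwo.add_self_eq_zero _
  by_cases hd : deg (restrict 0 f) ≤ 2
  · obtain ⟨l, hl, hw⟩ := exists_affine_wt_le_six (restrict 1 f + restrict 0 f)
    obtain ⟨q, hq, h⟩ := exists_join f hd hl
    refine ⟨q, hq, h.trans_le ?_⟩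
    have : wt (0 : BF 4) = 0 := by simp [wt_eq_sum_val]
    rwa [hff, this, zero_add]
  · obtain ⟨p, hp, hw⟩ := exists_quadratic_wt_le_two (sum_eq_zero_of_deg_lt (by omega)) hd
    have h3 := deg_add_le (deg_restrict_one_le hf) (hp.trans (by norm_num : 2 ≤ 3))
    have h4 : ¬ deg (restrict 1 f + p) ≤ 2 := by
      intro h4
      apply hd
      have e : restrict 0 f = (restrict 0 f + restrict 1 f) + (restrict 1 f + p) + p := by
        rw [← add_assoc, add_assoc (restrict 0 f), hff, add_zero, add_assoc, hff, add_zero]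
      rw [e]
      exact deg_add_le (deg_add_le h1 h4) hp
    obtain ⟨l, hl, hwl⟩ := exists_affine_wt_le_four (sum_eq_zero_of_deg_lt (by omega)) h4
    obtain ⟨q, hq, h⟩ := exists_join f hp hl
    exact ⟨q, hq, by omega⟩

lemma exists_quadratic_wt_le_eighteen {f : BF 6} (hf : deg f ≤ 3) :
    ∃ p : BF 6, deg p ≤ 2 ∧ wt (f + p) ≤ 18 := by
  obtain ⟨h0, -⟩ := (deg_succ_le_iff f).mp hf
  obtain ⟨p, hp, hw⟩ := exists_quadratic_wt_le_six h0
  have h3 := deg_add_le (deg_restrict_one_le hf) (hp.trans (by norm_num : 2 ≤ 3))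
  obtain ⟨l, hl, hwl⟩ := exists_affine_wt_le_twelve (f := restrict 1 f + p)
    (sum_eq_zero_of_deg_lt (by omega))
  obtain ⟨q, hq, h⟩ := exists_join f hp hl
  exact ⟨q, hq, by omega⟩

/-- The sum of `f` over the translate by `x` of the cube spanned by `a`, `b`, `c`, that is, the
third derivative of `f` in these directions at `x`. -/
def cubeSum {m : ℕ} (f : BF m) (x a b c : Fin m → ZMod 2) : ZMod 2 :=
  f x + f (x + a) + f (x + b) + f (x + a + b) +
    (f (x + c) + f (x + c + a) + f (x + c + b) + f (x + c + a + b))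

lemma cubeSum_add {m : ℕ} (f g : BF m) (x a b c : Fin m → ZMod 2) :
    cubeSum (f + g) x a b c = cubeSum f x a b c + cubeSum g x a b c := by
  simp only [cubeSum, Pi.add_apply]; ring

lemma cubeSum_eq_zero {m : ℕ} {f : BF m} (hf : deg f ≤ 2) (x a b c : Fin m → ZMod 2) :
    cubeSum f x a b c = 0 := by
  have hT : ∀ T : Finset (Fin m), T.card ≤ 2 → cubeSum (fun v => ∏ i ∈ T, v i) x a b c = 0 := by
    intro T hT
    obtain h | h | h : T.card = 0 ∨ T.card = 1 ∨ T.card = 2 := by omega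
    · rw [Finset.card_eq_zero] at h
      subst h
      simp only [cubeSum, Finset.prod_empty]
      decide
    · obtain ⟨i, rfl⟩ := Finset.card_eq_one.mp h
      simp only [cubeSum, Finset.prod_singleton, Pi.add_apply]
      grind
    · obtain ⟨i, j, hij, rfl⟩ := Finset.card_eq_two.mp h
      simp only [cubeSum, Finset.prod_pair hij, Pi.add_apply]
      grind
  have e : cubeSum f x a b c = ∑ T : Finset (Fin m),
      anfCoeff f T * cubeSum (fun v => ∏ i ∈ T, v i) x a b c := by
    simp only [cubeSum, mul_add, Finset.sum_add_distrib, ← eq_sum_anfCoeff]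
  rw [e]
  refine Finset.sum_eq_zero fun T _ => ?_
  by_cases h : 2 < T.card
  · rw [(deg_le_iff f 2).mp hf T h, zero_mul]
  · rw [hT T (by omega), mul_zero]

/-- The cubic function `Tr (x y z)` of `(x, y, z) ∈ 𝔽₄³ ≃ 𝔽₂⁶`, where `𝔽₄` has the basis `1, ω`. -/
def trCubic : BF 6 := fun v =>
  v 0 * v 2 * v 5 + v 0 * v 3 * v 4 + v 1 * v 2 * v 4 +
    v 0 * v 3 * v 5 + v 1 * v 2 * v 5 + v 1 * v 3 * v 4

/-- Multiplication by `ω` on `𝔽₄³ ≃ 𝔽₂⁶`. -/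
def mulOmega (v : Fin 6 → ZMod 2) : Fin 6 → ZMod 2 :=
  ![v 1, v 0 + v 1, v 3, v 2 + v 3, v 5, v 4 + v 5]

lemma deg_trCubic_le : deg trCubic ≤ 3 := by
  have h : ∀ i j k : Fin 6, i ≠ j → i ≠ k → j ≠ k →
      deg (fun v : Fin 6 → ZMod 2 => v i * v j * v k) ≤ 3 := by
    intro i j k hij hik hjk
    have hc : ({i, j, k} : Finset (Fin 6)).card ≤ 3 := Finset.card_le_three
    convert deg_mul_prod_le 1 {i, j, k} hc using 3 with v
    rw [one_mul, Finset.prod_insert (by simp [hij, hik]), Finset.prod_pair hjk, mul_assoc]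
  refine deg_add_le (deg_add_le (deg_add_le (deg_add_le (deg_add_le ?_ ?_) ?_) ?_) ?_) ?_ <;>
    exact h _ _ _ (by decide) (by decide) (by decide)

/-- The polarization of `v i * v j * v k`, a `3 × 3` permanent. -/
def perm (i j k : Fin 6) (a b c : Fin 6 → ZMod 2) : ZMod 2 :=
  c i * (a j * b k + a k * b j) + c j * (a i * b k + a k * b i) + c k * (a i * b j + a j * b i)

lemma cubeSum_mul_mul (i j k : Fin 6) (x a b c : Fin 6 → ZMod 2) :
    cubeSum (fun v => v i * v j * v k) x a b c = perm i j k a b c := by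
  simp only [cubeSum, Pi.add_apply, perm]
  grind

/-- The polarization of `trCubic`. -/
def trForm (a b c : Fin 6 → ZMod 2) : ZMod 2 :=
  perm 0 2 5 a b c + perm 0 3 4 a b c + perm 1 2 4 a b c +
    perm 0 3 5 a b c + perm 1 2 5 a b c + perm 1 3 4 a b c

lemma cubeSum_trCubic (x a b c : Fin 6 → ZMod 2) : cubeSum trCubic x a b c = trForm a b c := by
  have e : trCubic = (fun v => v 0 * v 2 * v 5) + (fun v => v 0 * v 3 * v 4) +
      (fun v => v 1 * v 2 * v 4) + (fun v => v 0 * v 3 * v 5) + (fun v => v 1 * v 2 * v 5) +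
      (fun v => v 1 * v 3 * v 4) := rfl
  rw [e]
  simp only [cubeSum_add, cubeSum_mul_mul, trForm]

lemma trForm_mulOmega (a c : Fin 6 → ZMod 2) : trForm a (mulOmega a) c = 0 := by
  simp [trForm, perm, mulOmega]
  grind

lemma mulOmega_add (a b : Fin 6 → ZMod 2) : mulOmega (a + b) = mulOmega a + mulOmega b := by
  ext i
  fin_cases i <;> simp [mulOmega] <;> ring

lemma mulOmega_mulOmega (a : Fin 6 → ZMod 2) : mulOmega (mulOmega a) = a + mulOmega a := by
  ext i
  fin_cases i <;> simp [mulOmega]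

lemma mulOmega_bijective : Function.Bijective mulOmega := by
  rw [← Finite.injective_iff_bijective]
  intro a b h
  have h2 := congrArg mulOmega h
  rw [mulOmega_mulOmega, mulOmega_mulOmega, h] at h2
  simpa using h2

lemma mulOmega_ne_self {a : Fin 6 → ZMod 2} (ha : a ≠ 0) : mulOmega a ≠ a := by
  intro h
  have h2 := congrArg mulOmega h
  rw [mulOmega_mulOmega, h] at h2
  exact ha (by simpa using h2)

/-- A vector `(y, y')` of `𝔽₄²` is a multiple of `(x, x')`, where `x ≠ 0`, if `x y' = x' y`;
here elements of `𝔽₄` are written in the basis `1, ω`. -/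
lemma eq_smul_of_minor_eq_zero : ∀ a₀ a₁ a₂ a₃ s t b₂ b₃ : ZMod 2, ¬(a₀ = 0 ∧ a₁ = 0) →
    let b₀ := s * a₀ + t * a₁
    let b₁ := s * a₁ + t * (a₀ + a₁)
    (a₀ * b₃ + a₃ * b₀) + (a₁ * b₂ + a₂ * b₁) + (a₁ * b₃ + a₃ * b₁) = 0 →
    (a₀ * b₂ + a₂ * b₀) + (a₀ * b₃ + a₃ * b₀) + (a₁ * b₂ + a₂ * b₁) = 0 →
    b₂ = s * a₂ + t * a₃ ∧ b₃ = s * a₃ + t * (a₂ + a₃) := by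
  decide +kernel

lemma exists_eq_smul : ∀ a₀ a₁ b₀ b₁ : ZMod 2, ¬(a₀ = 0 ∧ a₁ = 0) →
    ∃ s t, b₀ = s * a₀ + t * a₁ ∧ b₁ = s * a₁ + t * (a₀ + a₁) := by
  decide

lemma exists_eq_smul_add_smul_mulOmega {a b : Fin 6 → ZMod 2} (ha : a ≠ 0)
    (h : ∀ c, trForm a b c = 0) : ∃ s t : ZMod 2, b = s • a + t • mulOmega a := by
  have h0 := h (Pi.single 0 1)
  have h1 := h (Pi.single 1 1)
  have h2 := h (Pi.single 2 1)
  have h3 := h (Pi.single 3 1)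
  have h4 := h (Pi.single 4 1)
  have h5 := h (Pi.single 5 1)
  simp [trForm, perm] at h0 h1 h2 h3 h4 h5
  have fin : ∀ s t : ZMod 2, (b 0 = s * a 0 + t * a 1 ∧ b 1 = s * a 1 + t * (a 0 + a 1)) →
      (b 2 = s * a 2 + t * a 3 ∧ b 3 = s * a 3 + t * (a 2 + a 3)) →
      (b 4 = s * a 4 + t * a 5 ∧ b 5 = s * a 5 + t * (a 4 + a 5)) →
      ∃ s t : ZMod 2, b = s • a + t • mulOmega a := by
    rintro s t ⟨e0, e1⟩ ⟨e2, e3⟩ ⟨e4, e5⟩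
    refine ⟨s, t, ?_⟩
    ext i
    fin_cases i <;> simpa [mulOmega]
  by_cases ha0 : a 0 = 0 ∧ a 1 = 0
  · by_cases ha2 : a 2 = 0 ∧ a 3 = 0
    · have ha4 : ¬(a 4 = 0 ∧ a 5 = 0) := by
        refine fun ha4 => ha ?_
        ext i
        fin_cases i <;> simp [ha0, ha2, ha4]
      obtain ⟨s, t, e⟩ := exists_eq_smul _ _ (b 4) (b 5) ha4
      refine fin s t ?_ ?_ e
      · refine eq_smul_of_minor_eq_zero _ _ _ _ s t _ _ ha4 ?_ ?_ <;> simp only [← e.1, ← e.2]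
        · linear_combination h2
        · linear_combination h3
      · refine eq_smul_of_minor_eq_zero _ _ _ _ s t _ _ ha4 ?_ ?_ <;> simp only [← e.1, ← e.2]
        · linear_combination h0
        · linear_combination h1
    · obtain ⟨s, t, e⟩ := exists_eq_smul _ _ (b 2) (b 3) ha2
      refine fin s t ?_ e ?_
      · refine eq_smul_of_minor_eq_zero _ _ _ _ s t _ _ ha2 ?_ ?_ <;> simp only [← e.1, ← e.2]
        · linear_combination h4
        · linear_combination h5
      · refine eq_smul_of_minor_eq_zero _ _ _ _ s t _ _ ha2 ?_ ?_ <;> simp only [← e.1, ← e.2]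
        · linear_combination h0
        · linear_combination h1
  · obtain ⟨s, t, e⟩ := exists_eq_smul _ _ (b 0) (b 1) ha0
    refine fin s t e ?_ ?_
    · refine eq_smul_of_minor_eq_zero _ _ _ _ s t _ _ ha0 ?_ ?_ <;> simp only [← e.1, ← e.2]
      · linear_combination h4
      · linear_combination h5
    · refine eq_smul_of_minor_eq_zero _ _ _ _ s t _ _ ha0 ?_ ?_ <;> simp only [← e.1, ← e.2]
      · linear_combination h2
      · linear_combination h3

lemma eq_of_trForm_eq_zero {a b : Fin 6 → ZMod 2} (ha : a ≠ 0) (h : ∀ c, trForm a b c = 0) :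
    b = 0 ∨ b = a ∨ b = mulOmega a ∨ b = a + mulOmega a := by
  have hz : ∀ z : ZMod 2, z = 0 ∨ z = 1 := by decide
  obtain ⟨s, t, rfl⟩ := exists_eq_smul_add_smul_mulOmega ha h
  rcases hz s with rfl | rfl <;> rcases hz t with rfl | rfl <;> simp

lemma sq_sum_sgn {m : ℕ} (f : BF m) :
    (∑ x, sgn (f x)) ^ 2 = ∑ a, ∑ x, sgn (f x + f (x + a)) := by
  rw [sq, Finset.sum_mul_sum, Finset.sum_comm (s := Finset.univ) (t := Finset.univ)
    (f := fun a x => sgn (f x + f (x + a)))]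
  refine Finset.sum_congr rfl fun x _ => ?_
  rw [← Equiv.sum_comp (Equiv.addLeft x) fun y => sgn (f x) * sgn (f y)]
  simp [sgn_add]

/-- The sum of `g` over the `𝔽₄`-line spanned by `a ∈ 𝔽₄³`. -/
def lineSum (g : BF 6) (a : Fin 6 → ZMod 2) : ZMod 2 :=
  g 0 + g a + g (mulOmega a) + g (mulOmega (mulOmega a))

lemma lineSum_mulOmega (g : BF 6) (a : Fin 6 → ZMod 2) :
    lineSum g (mulOmega a) = lineSum g a := by
  have : mulOmega a + (a + mulOmega a) = a := by
    ext i; simp only [Pi.add_apply]; grind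
  have h3 : mulOmega (mulOmega (mulOmega a)) = a := by
    rw [mulOmega_mulOmega (mulOmega a), mulOmega_mulOmega, this]
  simp only [lineSum, h3]
  ring

lemma sum_lineSum {g : BF 6} (hg : ∑ v, g v = 0) : ∑ a, lineSum g a = 0 := by
  have h1 : ∑ a, g (mulOmega a) = 0 := by rw [mulOmega_bijective.sum_comp, hg]
  have h2 : ∑ a, g (mulOmega (mulOmega a)) = 0 := by
    rw [mulOmega_bijective.sum_comp fun a => g (mulOmega a), h1]
  simp only [lineSum, Finset.sum_add_distrib, hg, h1, h2, Finset.sum_const, add_zero]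
  simp
  exact Or.inl rfl

lemma exists_lineSum_ne_zero {g : BF 6}
    (hg : ∀ x a b c, cubeSum g x a b c = trForm a b c) :
    ∃ a, lineSum g a ≠ 0 := by
  by_contra! h
  have key : ∀ a b c, cubeSum (lineSum g) 0 a b c =
      cubeSum g 0 a b c + cubeSum g 0 (mulOmega a) (mulOmega b) (mulOmega c) +
        cubeSum g 0 (mulOmega (mulOmega a)) (mulOmega (mulOmega b)) (mulOmega (mulOmega c)) := by
    intro a b c
    have h0 : mulOmega 0 = 0 := by decide
    simp only [cubeSum, lineSum, mulOmega_add, zero_add, h0]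
    grind
  have hkey := key (Pi.single 0 1) (Pi.single 2 1) (Pi.single 5 1)
  rw [hg, hg, hg] at hkey
  simp only [cubeSum, h] at hkey
  revert hkey
  decide

lemma sum_sgn_derivative_eq_zero {g : BF 6}
    (hg : ∀ x a b c, cubeSum g x a b c = trForm a b c)
    {a : Fin 6 → ZMod 2} (ha : lineSum g a ≠ 0) :
    ∑ x, sgn (g x + g (x + a)) = 0 := by
  refine sum_sgn_eq_zero (fun x => g x + g (x + a)) (mulOmega a) fun x => ?_
  have h := hg 0 a (mulOmega a) x
  have h1 : lineSum g a = 1 := by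
    generalize lineSum g a = z at ha
    revert ha z; decide
  rw [trForm_mulOmega] at h
  simp only [cubeSum, lineSum, mulOmega_mulOmega, zero_add, add_right_comm x (mulOmega a) a] at *
  grind

lemma sum_sgn_derivative_le {g : BF 6}
    (hg : ∀ x a b c, cubeSum g x a b c = trForm a b c)
    {a : Fin 6 → ZMod 2} (ha : a ≠ 0) :
    ∑ x, sgn (g x + g (x + a)) ≤ 16 := by
  have hsq : (∑ x, sgn (g x + g (x + a))) ^ 2 =
      ∑ b, ∑ x, sgn (g x + g (x + a) + g (x + b) + g (x + a + b)) := by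
    rw [sq_sum_sgn fun x => g x + g (x + a)]
    refine Finset.sum_congr rfl fun b _ => Finset.sum_congr rfl fun x _ => ?_
    rw [add_right_comm x b a, add_assoc (g x + g (x + a))]
  have hb : ∀ b ∉ ({0, a, mulOmega a, a + mulOmega a} : Finset (Fin 6 → ZMod 2)),
      ∑ x, sgn (g x + g (x + a) + g (x + b) + g (x + a + b)) = 0 := by
    intro b hb
    obtain ⟨c, hc⟩ : ∃ c, trForm a b c ≠ 0 := by
      by_contra! h
      exact hb (by simpa using eq_of_trForm_eq_zero ha h)
    refine sum_sgn_eq_zero (fun x => g x + g (x + a) + g (x + b) + g (x + a + b)) c fun x => ?_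
    have h := hg x a b c
    have h1 : trForm a b c = 1 := by
      generalize trForm a b c = z at hc
      revert hc z; decide
    rw [h1] at h
    simp only [cubeSum] at h
    grind
  have hle : (∑ x, sgn (g x + g (x + a))) ^ 2 ≤ 4 * 64 := by
    rw [hsq, ← Finset.sum_subset (Finset.subset_univ _) fun b _ => hb b]
    refine (Finset.sum_le_card_nsmul _ _ 64 fun b _ => ?_).trans ?_
    · refine (Finset.sum_le_card_nsmul _ _ 1 fun x _ => sgn_le_one _).trans ?_
      simp
    · have := Finset.card_le_four (a := (0 : Fin 6 → ZMod 2)) (b := a) (c := mulOmega a)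
        (d := a + mulOmega a)
      simp only [nsmul_eq_mul]
      gcongr
      exact_mod_cast this
  nlinarith

lemma four_le_card_lineSum_ne_zero {g : BF 6}
    (hg : ∀ x a b c, cubeSum g x a b c = trForm a b c)
    (hsum : ∑ v, g v = 0) :
    4 ≤ (Finset.univ.filter fun a => lineSum g a ≠ 0).card := by
  obtain ⟨a, ha⟩ := exists_lineSum_ne_zero hg
  have ha0 : a ≠ 0 := by
    rintro rfl
    have h0 : mulOmega 0 = 0 := by decide
    apply ha
    simp only [lineSum, h0]
    grind
  have hsub : ({a, mulOmega a, mulOmega (mulOmega a)} : Finset (Fin 6 → ZMod 2)) ⊆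
      Finset.univ.filter fun a => lineSum g a ≠ 0 := by
    intro b hb
    simp only [Finset.mem_insert, Finset.mem_singleton] at hb
    rcases hb with rfl | rfl | rfl <;> simpa [lineSum_mulOmega] using ha
  have h1 : mulOmega a ≠ 0 := by
    intro h
    have h2 := mulOmega_mulOmega a
    rw [h] at h2
    exact ha0 (by simpa [show mulOmega 0 = 0 by decide] using h2.symm)
  have hcard : ({a, mulOmega a, mulOmega (mulOmega a)} : Finset (Fin 6 → ZMod 2)).card = 3 := by
    rw [Finset.card_eq_three]
    refine ⟨_, _, _, (mulOmega_ne_self ha0).symm, ?_, (mulOmega_ne_self h1).symm, rfl⟩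
    rw [mulOmega_mulOmega]
    simpa using h1
  have h3 := Finset.card_le_card hsub
  have heven : Even (Finset.univ.filter fun a => lineSum g a ≠ 0).card := by
    have h : Even (wt (lineSum g)) := even_wt (sum_lineSum hsum)
    have hz : ∀ z : ZMod 2, z ≠ 0 ↔ z = 1 := by decide
    simpa only [wt, hz] using h
  obtain ⟨k, hk⟩ := heven
  omega

lemma sum_sgn_sq_lt {g : BF 6}
    (hg : ∀ x a b c, cubeSum g x a b c = trForm a b c)
    (hsum : ∑ v, g v = 0) : (∑ v, sgn (g v)) ^ 2 < 1024 := by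
  have hle : ∀ a, ∑ x, sgn (g x + g (x + a)) ≤
      16 + (if a = 0 then 48 else 0) - if lineSum g a ≠ 0 then 16 else 0 := by
    intro a
    by_cases h : lineSum g a = 0
    · by_cases ha : a = 0
      · rw [if_pos ha, if_neg (not_not.mpr h)]
        refine (Finset.sum_le_card_nsmul _ _ 1 fun x _ => sgn_le_one _).trans ?_
        simp
      · simpa [h, ha] using sum_sgn_derivative_le hg ha
    · rw [sum_sgn_derivative_eq_zero hg h]
      split_ifs <;> simp
  have h4 := four_le_card_lineSum_ne_zero hg hsum
  have hcard : ∑ a, (if lineSum g a ≠ 0 then (16 : ℤ) else 0) =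
      16 * (Finset.univ.filter fun a => lineSum g a ≠ 0).card := by
    rw [← Finset.sum_filter, Finset.sum_const, nsmul_eq_mul, mul_comm]
  rw [sq_sum_sgn]
  refine (Finset.sum_le_sum fun a _ => hle a).trans_lt ?_
  rw [Finset.sum_sub_distrib, Finset.sum_add_distrib, hcard, Finset.sum_ite_eq']
  simp only [Finset.sum_const, nsmul_eq_mul, Finset.card_univ, Fintype.card_pi_const, ZMod.card,
    Finset.mem_univ, if_true]
  omega

lemma eighteen_le_wt_trCubic_add {p : BF 6} (hp : deg p ≤ 2) : 18 ≤ wt (trCubic + p) := by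
  have hsum : ∑ v, (trCubic + p) v = 0 :=
    sum_eq_zero_of_deg_lt ((deg_add_le deg_trCubic_le (hp.trans (by norm_num))).trans_lt
      (by norm_num : 3 < 6))
  have h := sum_sgn_sq_lt (g := trCubic + p) (fun x a b c => by
    rw [cubeSum_add, cubeSum_trCubic, cubeSum_eq_zero hp, add_zero]) hsum
  rw [sum_sgn] at h
  obtain ⟨k, hk⟩ := even_wt hsum
  by_contra! hlt
  have h32 : (32 : ℤ) ≤ 2 ^ 6 - 2 * wt (trCubic + p) := by omega
  exact absurd h (not_lt.mpr (pow_le_pow_left₀ (by norm_num) h32 2))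

lemma distRM_le_of_wt_le {m r n : ℕ} {f : BF m} (h : ∃ p : BF m, deg p ≤ r ∧ wt (f + p) ≤ n) :
    distRM m r f ≤ n := by
  obtain ⟨p, hp, hw⟩ := h
  have hmem : wt (f + p) ∈ {w | ∃ p : BF m, deg p ≤ r ∧ wt (f + p) = w} := ⟨p, hp, rfl⟩
  exact (Nat.sInf_le hmem).trans hw

theorem stmt10 :
    (∀ f : BF 6, deg f ≤ 3 → distRM 6 2 f ≤ 18) ∧
      (∃ f : BF 6, deg f ≤ 3 ∧ distRM 6 2 f = 18) := by
  have hle : ∀ f : BF 6, deg f ≤ 3 → distRM 6 2 f ≤ 18 := fun f hf =>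
    distRM_le_of_wt_le (exists_quadratic_wt_le_eighteen hf)
  refine ⟨hle, trCubic, deg_trCubic_le, (hle _ deg_trCubic_le).antisymm ?_⟩
  unfold distRM
  refine le_csInf (s := {w | ∃ p : BF 6, deg p ≤ 2 ∧ wt (trCubic + p) = w})
    ⟨wt (trCubic + 0), 0, deg_zero_le 2, rfl⟩ ?_
  rintro w ⟨p, hp, rfl⟩
  exact eighteen_le_wt_trCubic_add hp
end

section
/- The covering radius of RM(3,7) in RM(4,7) equals 20; that is, every Boolean function on 7 variables of degree at most 4 has distance at most 20 to RM(3,7), and some Boolean function on 7 variables of degree at most 4 has distance exactly 20 to RM(3,7). -/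
open MvPolynomial

/-- The square-free monomial function `∏ i ∈ A, vᵢ`. -/
def mono {m : ℕ} (A : Finset (Fin m)) : BF m := fun v => ∏ i ∈ A, v i

/-- The Reed–Muller code of order `r`, spanned by the monomials of degree at most `r`. -/
def RM (m r : ℕ) : Submodule (ZMod 2) (BF m) :=
  Submodule.span (ZMod 2) (mono '' {A | A.card ≤ r})

lemma mono_mem_RM {m r : ℕ} {A : Finset (Fin m)} (h : A.card ≤ r) : mono A ∈ RM m r :=
  Submodule.subset_span ⟨A, h, rfl⟩

lemma bf_add_self {m : ℕ} (f : BF m) : f + f = 0 :=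
  funext fun _ => CharTwo.add_self_eq_zero _

lemma repPoly_add {m : ℕ} (f g : BF m) : repPoly (f + g) = repPoly f + repPoly g := by
  simp [repPoly, add_smul, Finset.sum_add_distrib]

lemma repPoly_smul {m : ℕ} (c : ZMod 2) (f : BF m) : repPoly (c • f) = c • repPoly f := by
  simp [repPoly, Finset.smul_sum, smul_smul]

lemma repPoly_zero {m : ℕ} : repPoly (0 : BF m) = 0 := by
  simp [repPoly]

lemma prod_add_add_one {m : ℕ} (v w : Fin m → ZMod 2) :
    ∏ i, (w i + (v i + 1)) = if v = w then 1 else 0 := by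
  have key : ∀ a b : ZMod 2, a + (b + 1) = if b = a then 1 else 0 := by decide
  simp only [key, Finset.prod_ite_zero, Finset.prod_const_one, Finset.mem_univ, true_implies,
    funext_iff]

lemma eval_repPoly {m : ℕ} (f : BF m) (w : Fin m → ZMod 2) :
    eval w (repPoly f) = f w := by
  simp [repPoly, smul_eval, prod_add_add_one]

lemma repPoly_mono {m : ℕ} (A : Finset (Fin m)) : repPoly (mono A) = ∏ i ∈ A, X i := by
  have factor : ∀ i : Fin m, ∑ c : ZMod 2,
      (C (if i ∈ A then c else 1) * (X i + C (c + 1)) : MvPolynomial (Fin m) (ZMod 2)) =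
        if i ∈ A then X i else 1 := by
    intro i
    have two : ∀ g : ZMod 2 → MvPolynomial (Fin m) (ZMod 2), ∑ c, g c = g 0 + g 1 :=
      fun g => Fin.sum_univ_two g
    have h11 : (1 + 1 : ZMod 2) = 0 := by decide
    rw [two]
    split_ifs
    · simp [h11]
    · simp only [h11, map_zero, map_one, zero_add, one_mul, add_zero]
      rw [add_right_comm, CharTwo.add_self_eq_zero, zero_add]
  rw [← Finset.prod_ite_mem_eq, ← Finset.prod_congr rfl fun i _ => factor i,
    Finset.prod_univ_sum, Fintype.piFinset_univ]
  refine Finset.sum_congr rfl fun v _ => ?_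
  rw [Finset.prod_mul_distrib, ← map_prod, Finset.prod_ite_mem_eq, smul_eq_C_mul]
  rfl

lemma deg_le_iff_mem_RM {m r : ℕ} (f : BF m) : deg f ≤ r ↔ f ∈ RM m r := by
  constructor
  · intro h
    have hf : f = ∑ s ∈ (repPoly f).support, coeff s (repPoly f) • mono s.support := by
      funext w
      rw [← eval_repPoly f w, eval_eq]
      simp only [Finset.sum_apply, Pi.smul_apply, smul_eq_mul, mono]
      refine Finset.sum_congr rfl fun s _ => congrArg _ (Finset.prod_congr rfl fun i hi => ?_)
      have pow_eq : ∀ (a : ZMod 2) (n : ℕ), n ≠ 0 → a ^ n = a := by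
        intro a n hn
        obtain rfl | rfl : a = 0 ∨ a = 1 := by revert a; decide
        · exact zero_pow hn
        · exact one_pow n
      exact pow_eq _ _ (Finsupp.mem_support_iff.1 hi)
    rw [hf]
    refine Submodule.sum_mem _ fun s hs => Submodule.smul_mem _ _ (mono_mem_RM ?_)
    refine le_trans ?_ ((le_totalDegree hs).trans h)
    rw [Finsupp.sum, Finset.card_eq_sum_ones]
    exact Finset.sum_le_sum fun i hi => Nat.one_le_iff_ne_zero.2 (Finsupp.mem_support_iff.1 hi)
  · intro h
    induction h using Submodule.span_induction with
    | mem f hf =>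
      obtain ⟨A, hA, rfl⟩ := hf
      rw [deg, repPoly_mono]
      refine (totalDegree_finsetProd _ _).trans ?_
      simpa using hA
    | zero => simp [deg, repPoly_zero]
    | add f g _ _ hf hg =>
      rw [deg, repPoly_add]
      exact (totalDegree_add _ _).trans (max_le hf hg)
    | smul c f _ hf =>
      rw [deg, repPoly_smul]
      exact (totalDegree_smul_le _ _).trans hf

lemma wt_add_le {m : ℕ} (f g : BF m) : wt (f + g) ≤ wt f + wt g := by
  refine le_trans (Finset.card_le_card fun v hv => ?_) (Finset.card_union_le _ _)
  simp only [Finset.mem_filter, Finset.mem_univ, true_and, Finset.mem_union, Pi.add_apply] at *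
  revert hv
  generalize f v = a
  generalize g v = b
  revert a b
  decide

/-- The substitution `xᵢ ↦ xᵢ + xⱼ`. -/
def transvection {m : ℕ} (i j : Fin m) (v : Fin m → ZMod 2) : Fin m → ZMod 2 :=
  Function.update v i (v i + v j)

lemma transvection_involutive {m : ℕ} {i j : Fin m} (h : i ≠ j) :
    Function.Involutive (transvection i j) := by
  intro v
  simp [transvection, Function.update_of_ne h.symm, add_assoc, CharTwo.add_self_eq_zero]

lemma wt_comp_transvection {m : ℕ} {i j : Fin m} (h : i ≠ j) (f : BF m) :
    wt (f ∘ transvection i j) = wt f :=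
  Finset.card_equiv (transvection_involutive h).toPerm (by simp)

lemma mono_comp_transvection {m : ℕ} {i j : Fin m} (h : i ≠ j) (A : Finset (Fin m)) :
    mono A ∘ transvection i j =
      mono A + if i ∈ A then mono (insert j (A.erase i)) else 0 := by
  funext v
  by_cases hi : i ∈ A
  · have hrest : ∏ k ∈ A.erase i, transvection i j v k = ∏ k ∈ A.erase i, v k :=
      Finset.prod_congr rfl fun k hk => Function.update_of_ne (Finset.ne_of_mem_erase hk) _ _
    have hins : ∏ k ∈ insert j (A.erase i), v k = v j * ∏ k ∈ A.erase i, v k := by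
      by_cases hj : j ∈ A.erase i
      · rw [Finset.insert_eq_of_mem hj, ← Finset.mul_prod_erase _ _ hj, ← mul_assoc,
          (by decide : ∀ a : ZMod 2, a * a = a)]
      · rw [Finset.prod_insert hj]
    simp only [Function.comp, mono, Pi.add_apply, if_pos hi]
    rw [← Finset.mul_prod_erase _ _ hi, ← Finset.mul_prod_erase _ (fun k => v k) hi, hrest, hins,
      ← add_mul]
    simp [transvection]
  · simp only [Function.comp, mono, Pi.add_apply, if_neg hi, Pi.zero_apply, add_zero]
    refine Finset.prod_congr rfl fun k hk => Function.update_of_ne ?_ _ _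
    rintro rfl
    exact hi hk

lemma comp_transvection_mem_RM {m r : ℕ} {i j : Fin m} (h : i ≠ j) {f : BF m}
    (hf : f ∈ RM m r) : f ∘ transvection i j ∈ RM m r := by
  induction hf using Submodule.span_induction with
  | mem f hf =>
    obtain ⟨A, hA, rfl⟩ := hf
    rw [mono_comp_transvection h]
    refine Submodule.add_mem _ (mono_mem_RM hA) ?_
    split_ifs with hi
    · refine mono_mem_RM ((Finset.card_insert_le _ _).trans ?_)
      rw [Finset.card_erase_add_one hi]
      exact hA
    · exact Submodule.zero_mem _
  | zero => exact Submodule.zero_mem _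
  | add f g _ _ hf hg => exact Submodule.add_mem _ hf hg
  | smul c f _ hf => exact Submodule.smul_mem _ c hf

/-- The set of variables encoded by the binary digits of `k`. -/
def supp (k : ℕ) : Finset (Fin 7) := Finset.univ.filter fun i => k.testBit i

/-- The codes of the monomials of degree `4` in `7` variables, in decreasing order. -/
def quarticCodes : List ℕ :=
  [120, 116, 114, 113, 108, 106, 105, 102, 101, 99, 92, 90, 89, 86, 85, 83, 78, 77, 75, 71, 60, 58,
    57, 54, 53, 51, 46, 45, 43, 39, 30, 29, 27, 23, 15]

/-- The quartic form whose monomials are the `k` in `quarticCodes` with bit `k` of `T` set. -/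
def quartic (T : ℕ) : BF 7 :=
  ∑ k ∈ quarticCodes.toFinset, if T.testBit k then mono (supp k) else 0

/-- The numbers that are bitwise sums of powers `2 ^ k` with `k` in the list. -/
inductive XorSpan (L : List ℕ) : ℕ → Prop
  | zero : XorSpan L 0
  | step {k l : ℕ} : k ∈ L → XorSpan L l → XorSpan L (2 ^ k ^^^ l)

lemma XorSpan.xor {L : List ℕ} {a b : ℕ} (ha : XorSpan L a) (hb : XorSpan L b) :
    XorSpan L (a ^^^ b) := by
  induction ha with
  | zero => simpa using hb
  | step hk _ ih => rw [Nat.xor_assoc]; exact .step hk ih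

lemma XorSpan.two_pow {L : List ℕ} {k : ℕ} (hk : k ∈ L) : XorSpan L (2 ^ k) := by
  simpa using XorSpan.step hk .zero

lemma XorSpan.cons {k : ℕ} {L : List ℕ} {l : ℕ} (h : XorSpan (k :: L) l) :
    XorSpan L l ∨ ∃ l', XorSpan L l' ∧ l = 2 ^ k ^^^ l' := by
  induction h with
  | zero => exact .inl .zero
  | @step a l ha _ ih =>
    rcases List.mem_cons.1 ha with rfl | ha
    · rcases ih with ih | ⟨l', hl', rfl⟩
      · exact .inr ⟨l, ih, rfl⟩
      · left
        simpa [← Nat.xor_assoc] using hl'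
    · rcases ih with ih | ⟨l', hl', rfl⟩
      · exact .inl (.step ha ih)
      · refine .inr ⟨2 ^ a ^^^ l', .step ha hl', ?_⟩
        rw [← Nat.xor_assoc, ← Nat.xor_assoc, Nat.xor_comm (2 ^ a)]

lemma XorSpan.lt_two_pow {L : List ℕ} {F : ℕ → ℕ} (h0 : F 0 = 0)
    (hF : ∀ a b, F (a ^^^ b) = F a ^^^ F b) {p : ℕ} (hL : ∀ k ∈ L, F (2 ^ k) < 2 ^ p) {l : ℕ}
    (h : XorSpan L l) : F l < 2 ^ p := by
  induction h with
  | zero => rw [h0]; positivity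
  | step hk _ ih => rw [hF]; exact Nat.xor_lt_two_pow (hL _ hk) ih

lemma quartic_zero : quartic 0 = 0 := by simp [quartic]

lemma quartic_xor (a b : ℕ) : quartic (a ^^^ b) = quartic a + quartic b := by
  rw [quartic, quartic, quartic, ← Finset.sum_add_distrib]
  refine Finset.sum_congr rfl fun k _ => ?_
  rw [Nat.testBit_xor]
  cases a.testBit k <;> cases b.testBit k <;> simp [bf_add_self]

lemma quartic_two_pow {k : ℕ} (hk : k ∈ quarticCodes) : quartic (2 ^ k) = mono (supp k) := by
  simp [quartic, Nat.testBit_two_pow, hk]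

/-- The positions below `128` whose `i`-th binary digit is `1`. -/
def digitMask (i : ℕ) : ℕ := ((2 ^ 128 - 1) / (2 ^ 2 ^ i + 1)) <<< 2 ^ i

/-- The action of `xᵢ ↦ xᵢ + xⱼ` on quartic forms, up to terms of lower degree. -/
def act (g : ℕ × ℕ) (T : ℕ) : ℕ :=
  T ^^^ (((T &&& (digitMask g.1 ^^^ (digitMask g.1 &&& digitMask g.2))) <<< 2 ^ g.2) >>> 2 ^ g.1)

lemma act_xor (g : ℕ × ℕ) (a b : ℕ) : act g (a ^^^ b) = act g a ^^^ act g b := by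
  simp only [act, Nat.and_xor_distrib_right, Nat.shiftLeft_xor_distrib,
    Nat.shiftRight_xor_distrib]
  ac_rfl

lemma act_zero (g : ℕ × ℕ) : act g 0 = 0 := by simp [act]

/-- The successive action of a list of transvections. -/
def actWord (w : List (ℕ × ℕ)) (T : ℕ) : ℕ := w.foldl (fun T g => act g T) T

lemma actWord_xor (w : List (ℕ × ℕ)) (a b : ℕ) :
    actWord w (a ^^^ b) = actWord w a ^^^ actWord w b := by
  induction w generalizing a b with
  | nil => rfl
  | cons g w ih => simp only [actWord, List.foldl_cons, act_xor] at ih ⊢; exact ih _ _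

lemma actWord_zero (w : List (ℕ × ℕ)) : actWord w 0 = 0 := by
  induction w with
  | nil => rfl
  | cons g w ih => simpa only [actWord, List.foldl_cons, act_zero] using ih

lemma act_two_pow : ∀ i j : Fin 7, i ≠ j → ∀ k ∈ quarticCodes,
    (i ∉ supp k ∧ act (i, j) (2 ^ k) = 2 ^ k) ∨
    (i ∈ supp k ∧ j ∈ supp k ∧ act (i, j) (2 ^ k) = 2 ^ k) ∨
    (i ∈ supp k ∧ ∃ k' ∈ quarticCodes, supp k' = insert j ((supp k).erase i) ∧
      act (i, j) (2 ^ k) = 2 ^ k ^^^ 2 ^ k') := by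
  decide +kernel

lemma card_supp : ∀ k ∈ quarticCodes, (supp k).card = 4 := by decide +kernel

lemma exists_supp_eq : ∀ A : Finset (Fin 7), ∃ k < 128, supp k = A := by
  decide +kernel


/-- The quartic form `T` is, modulo cubics, at distance at most `20` from zero. -/
def Near (T : ℕ) : Prop := ∃ p ∈ RM 7 3, wt (quartic T + p) ≤ 20

/-- A list of transvections of `7` variables. -/
def ValidWord (w : List (ℕ × ℕ)) : Prop := ∀ g ∈ w, g.1 < 7 ∧ g.2 < 7 ∧ g.1 ≠ g.2

instance (w : List (ℕ × ℕ)) : Decidable (ValidWord w) := by unfold ValidWord; infer_instance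

lemma xorSpan_act {i j : Fin 7} (h : i ≠ j) {T : ℕ} (hT : XorSpan quarticCodes T) :
    XorSpan quarticCodes (act (i, j) T) := by
  induction hT with
  | zero => rw [act_zero]; exact .zero
  | step hk _ ih =>
    rw [act_xor]
    refine .xor ?_ ih
    rcases act_two_pow i j h _ hk with ⟨-, e⟩ | ⟨-, -, e⟩ | ⟨-, k', hk', -, e⟩ <;> rw [e]
    · exact .two_pow hk
    · exact .two_pow hk
    · exact .step hk (.two_pow hk')

lemma quartic_act_add_comp_mem {i j : Fin 7} (h : i ≠ j) {T : ℕ} (hT : XorSpan quarticCodes T) :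
    quartic (act (i, j) T) + quartic T ∘ transvection i j ∈ RM 7 3 := by
  induction hT with
  | zero => rw [act_zero, quartic_zero]; exact Submodule.zero_mem _
  | @step k l hk _ ih =>
    have split : quartic (act (i, j) (2 ^ k ^^^ l)) + quartic (2 ^ k ^^^ l) ∘ transvection i j =
        (quartic (act (i, j) (2 ^ k)) + quartic (2 ^ k) ∘ transvection i j) +
        (quartic (act (i, j) l) + quartic l ∘ transvection i j) := by
      rw [act_xor, quartic_xor, quartic_xor, Pi.add_comp]
      abel
    rw [split]
    refine Submodule.add_mem _ ?_ ih
    rw [quartic_two_pow hk, mono_comp_transvection h]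
    rcases act_two_pow i j h _ hk with ⟨hi, e⟩ | ⟨hi, hj, e⟩ | ⟨hi, k', hk', hs, e⟩ <;> rw [e]
    · rw [quartic_two_pow hk, if_neg hi, add_zero, bf_add_self]
      exact Submodule.zero_mem _
    · rw [quartic_two_pow hk, if_pos hi, ← add_assoc, bf_add_self, zero_add,
        Finset.insert_eq_of_mem (Finset.mem_erase.2 ⟨h.symm, hj⟩)]
      apply mono_mem_RM
      rw [Finset.card_erase_of_mem hi, card_supp k hk]
    · rw [quartic_xor, quartic_two_pow hk, quartic_two_pow hk', if_pos hi, hs, bf_add_self]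
      exact Submodule.zero_mem _

lemma near_of_near_act {i j : Fin 7} (h : i ≠ j) {T : ℕ} (hT : XorSpan quarticCodes T)
    (hn : Near (act (i, j) T)) : Near T := by
  obtain ⟨p, hp, hw⟩ := hn
  refine ⟨(quartic (act (i, j) T) + quartic T ∘ transvection i j + p) ∘ transvection i j,
    comp_transvection_mem_RM h (Submodule.add_mem _ (quartic_act_add_comp_mem h hT) hp), ?_⟩
  have e : quartic T + (quartic (act (i, j) T) + quartic T ∘ transvection i j + p) ∘
      transvection i j = (quartic (act (i, j) T) + p) ∘ transvection i j := by
    funext v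
    simp only [Pi.add_apply, Function.comp_apply, transvection_involutive h v]
    linear_combination CharTwo.add_self_eq_zero (quartic T v)
  rwa [e, wt_comp_transvection h]

lemma near_of_near_actWord {w : List (ℕ × ℕ)} (hw : ValidWord w) {T : ℕ}
    (hT : XorSpan quarticCodes T) (hn : XorSpan quarticCodes (actWord w T) → Near (actWord w T)) :
    Near T := by
  induction w generalizing T with
  | nil => exact hn hT
  | cons g w ih =>
    obtain ⟨h1, h2, h12⟩ := hw g List.mem_cons_self
    have hne : (⟨g.1, h1⟩ : Fin 7) ≠ ⟨g.2, h2⟩ := fun h => h12 (congrArg Fin.val h)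
    exact near_of_near_act hne hT
      (ih (fun g hg => hw g (List.mem_cons_of_mem _ hg)) (xorSpan_act hne hT) hn)

/-- The point of `𝔽₂⁷` whose coordinates are the binary digits of `c`. -/
def point (c : ℕ) : Fin 7 → ZMod 2 := fun i => if i ∈ supp c then 1 else 0

lemma single_point (c : ℕ) :
    (Pi.single (point c) 1 : BF 7) = ∑ A, if supp c ⊆ A then mono A else 0 := by
  funext w
  have hsum : (∑ A, if supp c ⊆ A then mono A else 0 : BF 7) w =
      ∑ A : Finset (Fin 7), (∏ i ∈ A, w i) * ∏ i ∈ Finset.univ \ A, (point c i + 1) := by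
    rw [Finset.sum_apply]
    refine Finset.sum_congr rfl fun A _ => ?_
    have hf : ∀ i, point c i + 1 = if i ∉ supp c then 1 else 0 := by
      intro i
      by_cases hi : i ∈ supp c <;> simp [point, hi, CharTwo.add_self_eq_zero]
    simp only [hf, Finset.prod_ite_zero, Finset.prod_const_one]
    by_cases hA : supp c ⊆ A
    · rw [if_pos hA, if_pos]
      · simp [mono]
      · intro i hi h
        exact (Finset.mem_sdiff.1 hi).2 (hA h)
    · rw [if_neg hA, if_neg]
      · simp
      · intro h
        refine hA fun i hi => ?_
        by_contra hiA
        exact h i (by simp [hiA]) hi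
  rw [hsum, ← Finset.powerset_univ, ← Finset.prod_add, prod_add_add_one, Pi.single_apply]
  simp only [eq_comm]

lemma wt_single {m : ℕ} (v : Fin m → ZMod 2) : wt (Pi.single v 1 : BF m) ≤ 1 := by
  refine (Finset.card_le_card (t := {v}) fun w hw => ?_).trans_eq (Finset.card_singleton v)
  by_contra h
  simp_all

lemma wt_sum_single {m : ℕ} (S : List (Fin m → ZMod 2)) :
    wt (S.map fun v => (Pi.single v 1 : BF m)).sum ≤ S.length := by
  induction S with
  | nil => simp [wt]
  | cons v S ih =>
    rw [List.map_cons, List.sum_cons, List.length_cons, add_comm S.length]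
    exact (wt_add_le _ _).trans (add_le_add (wt_single v) ih)

lemma supp_subset_iff {c : ℕ} (hc : c < 128) (k : ℕ) : supp c ⊆ supp k ↔ c &&& k = c := by
  constructor
  · intro h
    refine Nat.eq_of_testBit_eq fun i => ?_
    rw [Nat.testBit_and]
    by_cases hi : i < 7
    · have := @h ⟨i, hi⟩
      simp only [supp, Finset.mem_filter, Finset.mem_univ, true_and] at this
      cases hci : c.testBit i <;> simp_all
    · rw [Nat.testBit_lt_two_pow (x := c) (i := i), Bool.false_and]
      exact hc.trans_le (Nat.pow_le_pow_right (n := 2) (by norm_num) (not_lt.1 hi))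
  · intro h i
    simp only [supp, Finset.mem_filter, Finset.mem_univ, true_and]
    intro hi
    rw [← h, Nat.testBit_and, Bool.and_eq_true] at hi
    exact hi.2

lemma sum_supp {M : Type*} [AddCommMonoid M] (F : Finset (Fin 7) → M) :
    ∑ A, F A = ∑ k ∈ Finset.range 128, F (supp k) := by
  have hinj : Set.InjOn supp (Finset.range 128 : Set ℕ) := by
    intro a ha b hb h
    simp only [Finset.coe_range, Set.mem_Iio] at ha hb
    have h1 := (supp_subset_iff ha b).1 h.subset
    have h2 := (supp_subset_iff hb a).1 h.superset
    rw [← h1, Nat.and_comm, h2]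
  have himage : (Finset.range 128).image supp = Finset.univ := by
    rw [Finset.eq_univ_iff_forall]
    intro A
    obtain ⟨k, hk, hkA⟩ := exists_supp_eq A
    exact Finset.mem_image.2 ⟨k, Finset.mem_range.2 hk, hkA⟩
  rw [← Finset.sum_image hinj, himage]

lemma sum_single_point (S : List ℕ) (hS : ∀ c ∈ S, c < 128) :
    (S.map fun c => (Pi.single (point c) 1 : BF 7)).sum =
      ∑ k ∈ Finset.range 128, (S.countP fun c => c &&& k == c) • mono (supp k) := by
  induction S with
  | nil => simp
  | cons c S ih =>
    rw [List.map_cons, List.sum_cons, ih fun c hc => hS c (List.mem_cons_of_mem _ hc),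
      single_point, sum_supp, ← Finset.sum_add_distrib]
    refine Finset.sum_congr rfl fun k _ => ?_
    rw [List.countP_cons]
    simp only [supp_subset_iff (hS c List.mem_cons_self), beq_iff_eq]
    split_ifs
    · rw [add_smul, one_smul, add_comm]
    · simp

/-- Whether the point set `S` agrees with the quartic form `T` up to cubics. -/
def certifies (T : ℕ) (S : List ℕ) : Bool :=
  S.length ≤ 20 && S.all (· < 128) && (List.range 128).all fun k =>
    (supp k).card ≤ 3 ||
      ((S.countP fun c => c &&& k == c) + if k ∈ quarticCodes ∧ T.testBit k then 1 else 0) % 2 == 0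

lemma near_of_certifies {T : ℕ} {S : List ℕ} (h : certifies T S) : Near T := by
  simp only [certifies, Bool.and_eq_true, List.all_eq_true, decide_eq_true_eq, List.mem_range,
    Bool.or_eq_true, beq_iff_eq] at h
  obtain ⟨⟨hlen, hS⟩, hk⟩ := h
  set f := (S.map fun c => (Pi.single (point c) 1 : BF 7)).sum with hf
  refine ⟨quartic T + f, ?_, ?_⟩
  · have hq : quartic T = ∑ k ∈ Finset.range 128,
        (if k ∈ quarticCodes ∧ T.testBit k then 1 else 0) • mono (supp k) := by
      have hsub : quarticCodes.toFinset ⊆ Finset.range 128 := by decide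
      rw [quartic, ← Finset.sum_subset hsub]
      · refine Finset.sum_congr rfl fun k hk => ?_
        simp [List.mem_toFinset.1 hk]
      · intro k _ hk
        rw [List.mem_toFinset] at hk
        simp [hk]
    rw [hq, hf, sum_single_point S hS, ← Finset.sum_add_distrib]
    refine Submodule.sum_mem _ fun k hkr => ?_
    rcases hk k (Finset.mem_range.1 hkr) with h3 | h2
    · exact Submodule.add_mem _ (nsmul_mem (mono_mem_RM h3) _) (nsmul_mem (mono_mem_RM h3) _)
    · obtain ⟨n, hn⟩ := Nat.dvd_of_mod_eq_zero h2
      rw [← add_smul, add_comm, hn, mul_smul, two_smul, bf_add_self]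
      exact Submodule.zero_mem _
  · rw [← add_assoc, bf_add_self, zero_add, hf]
    have := wt_sum_single (S.map point)
    rw [List.map_map, List.length_map] at this
    exact this.trans hlen

/-- The words used in the reduction for all but the last stages. -/
def lowWords : List (List (ℕ × ℕ)) :=
  [[(5, 0), (5, 1)], [(5, 3), (6, 4)], [(5, 2), (5, 4)], [(3, 2), (6, 3)], [(4, 2), (6, 1)],
    [(6, 2)], [(3, 0), (4, 3)], [(4, 1), (5, 2)], [(1, 0), (5, 0)], [(2, 0), (4, 0)], [(2, 1), (3,
    0)], [(4, 0), (6, 4)], [(6, 0)], [(6, 1)], [(6, 3)], [(3, 1), (6, 4)], [(6, 5)], [(4, 3), (6,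
    4)], [(2, 1), (5, 4)], [(4, 2), (5, 3)], [(3, 0), (6, 4)], [(4, 1), (5, 0)], [(2, 1), (4, 3)],
    [(1, 0), (4, 3)], [(2, 0), (5, 3)], [(3, 1), (4, 2)], [(3, 2), (4, 3)], [(5, 0)], [(4, 0), (6,
    3)], [(5, 1), (5, 4)], [(4, 3)], [(5, 2)], [(6, 4)], [(2, 0), (6, 5)], [(3, 0), (5, 2)], [(3,
    0), (6, 5)], [(3, 2), (6, 5)], [(5, 1)], [(1, 0), (3, 2)], [(2, 0), (3, 1)]]

/-- The words used at the code `99`. -/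
def midWords : List (List (ℕ × ℕ)) :=
  [[(1, 0), (0, 1)], [(2, 1), (1, 2)], [(3, 2), (2, 3)], [(4, 3), (3, 4)], [(2, 0)]]

/-- The words used at the code `71`. -/
def highWords : List (List (ℕ × ℕ)) :=
  [[(1, 0), (0, 1)], [(2, 1), (1, 2)], [(3, 2), (2, 3)], [(5, 3), (3, 5)], [(4, 2), (2, 4)],
    [(5, 0)], [(4, 2), (5, 2)], [(0, 1), (2, 3)], [(3, 0), (0, 3)], [(5, 4), (4, 5)]]

/-- The words used for complete quartic forms. -/
def lastWords : List (List (ℕ × ℕ)) :=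
  [[(6, 5), (5, 6)], [(1, 2), (5, 6)], [(5, 4), (4, 5)], [(4, 1), (1, 4)], [(0, 2), (4, 6)],
    [(4, 3), (3, 4)], [(6, 0), (0, 6)], [(1, 0), (0, 1)], [(6, 0)], [(2, 1), (1, 2)], [(3, 2), (2,
    3)], [(6, 1)], [(0, 1), (3, 4)], [(6, 3)], [(1, 2), (4, 5)], [(6, 3), (3, 6)], [(4, 0)], [(4,
    2)], [(6, 1), (1, 6)]]

/-- A stage of the reduction: a code, the number of low digits not yet decided, and the words that
may be used to lower the digits already decided. -/
abbrev Stage := ℕ × ℕ × List (List (ℕ × ℕ))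

/-- The stages of the reduction, one for each monomial of degree `4`. -/
def stages : List Stage :=
  quarticCodes.map fun k =>
    if k = 99 then (k, 96, midWords) else
    if k = 71 then (k, 64, highWords) else
    if k = 15 then (k, k, lastWords) else (k, k, lowWords)

/-- The quartic forms that are minimal for the reduction, with point sets agreeing with them up to
cubics. -/
def minimalForms : List (ℕ × List ℕ) :=
  [(0, []),
   (32768, [0, 3, 7, 10, 14, 20, 25, 29, 32, 35, 39, 42, 46, 52, 57, 61, 64, 80, 96, 112]),
   (549890031616, [8, 14, 24, 26, 32, 36, 37, 47, 49, 59, 72, 78, 88, 90, 96, 100, 101, 111,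
      113, 123]),
   (2286985259515904, [28, 29, 32, 35, 38, 39, 50, 52, 57, 60, 92, 93, 96, 99, 102, 103, 114,
      116, 121, 124]),
   (2361183250231452499968, [21, 23, 35, 39, 51, 53, 67, 69, 71, 73, 83, 89, 101, 105, 119, 121]),
   (2361185528420082122752, [2, 15, 22, 26, 32, 47, 48, 62, 66, 71, 86, 87, 90, 95, 96, 103, 112,
      119, 126, 127]),
   (2361327356622898462720, [9, 11, 13, 15, 65, 75, 77, 79, 81, 89, 97, 105, 113, 121]),
   (2361327356623972204544, [0, 5, 16, 20, 32, 33, 40, 44, 59, 63, 69, 72, 84, 88, 97, 108, 112,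
      120, 123, 127]),
   (9822522293420041764339712, [34, 38, 40, 42, 48, 54, 72, 74, 82, 86, 88, 94, 98, 102, 112,
      114, 120, 126]),
   (9822522293420042838081536, [22, 23, 34, 36, 50, 55, 60, 62, 64, 70, 72, 76, 84, 87, 106, 110,
      112, 119, 120, 122]),
   (9822522293446430043406336, [0, 3, 16, 21, 27, 29, 40, 43, 46, 47, 51, 55, 56, 62, 69, 70, 77,
      79, 86, 87]),
   (9822522302392056646991872, [7, 9, 17, 18, 23, 26, 37, 47, 55, 61, 69, 73, 82, 89, 90, 93,
      103, 111, 113, 121]),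
   (633864287971815392490861625344, [2, 8, 17, 27, 34, 43, 48, 57, 66, 73, 83, 88, 96, 97, 98, 99,
      102, 110, 118, 126]),
   (633864287971959402125821214720, [12, 13, 21, 23, 28, 31, 33, 36, 43, 47, 51, 53, 59, 60, 97,
      99, 100, 103, 108, 109]),
   (633864287972085538099759677440, [5, 14, 20, 31, 34, 42, 44, 45, 51, 58, 68, 78, 87, 93, 103,
      111, 114, 115, 117, 124]),
   (633864287972950194043976941568, [3, 4, 5, 6, 35, 39, 65, 68, 85, 86, 89, 91, 102, 103, 105,
      109, 113, 118, 123, 125])]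

/-- Every extension of `x` by the codes of the stages is minimal or can be lowered. -/
def reduces : List Stage → ℕ → Bool
  | [], x => minimalForms.any fun e => e.1 == x
  | s :: t, x =>
    ((s.2.2.any fun w => (actWord w x >>> s.2.1).blt (x >>> s.2.1)) || reduces t x) &&
    ((s.2.2.any fun w => (actWord w (x ^^^ 2 ^ s.1) >>> s.2.1).blt ((x ^^^ 2 ^ s.1) >>> s.2.1)) ||
      reduces t (x ^^^ 2 ^ s.1))

/-- At each stage, the words are valid and do not mix the undecided digits into the decided ones. -/
def separated : List Stage → Bool
  | [] => true
  | s :: t => (s.2.2.all fun w => decide (ValidWord w)) &&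
      (t.all fun e => e.1 < s.2.1 && s.2.2.all fun w => actWord w (2 ^ e.1) < 2 ^ s.2.1) &&
      separated t

lemma actWord_lt {w : List (ℕ × ℕ)} {L : List ℕ} {p x l : ℕ}
    (hp : ∀ e ∈ L, e < p) (hw : ∀ e ∈ L, actWord w (2 ^ e) < 2 ^ p)
    (hx : actWord w x >>> p < x >>> p) (hl : XorSpan L l) : actWord w (x ^^^ l) < x ^^^ l := by
  have h1 : l < 2 ^ p := XorSpan.lt_two_pow (F := id) rfl (fun _ _ => rfl)
    (fun k hk => Nat.pow_lt_pow_right (by norm_num) (hp k hk)) hl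
  have h2 : actWord w l < 2 ^ p := hl.lt_two_pow (actWord_zero w) (actWord_xor w) hw
  by_contra hle
  have := Nat.div_le_div_right (c := 2 ^ p) (not_lt.1 hle)
  rw [← Nat.shiftRight_eq_div_pow, ← Nat.shiftRight_eq_div_pow, actWord_xor,
    Nat.shiftRight_xor_distrib, Nat.shiftRight_xor_distrib,
    Nat.shiftRight_eq_zero _ _ h1, Nat.shiftRight_eq_zero _ _ h2, Nat.xor_zero, Nat.xor_zero] at this
  exact absurd hx (not_lt.2 this)

lemma minimal_or_actWord_lt {t : List Stage} {x l : ℕ} (hs : separated t) (hr : reduces t x)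
    (hl : XorSpan (t.map Prod.fst) l) :
    (∃ S, (x ^^^ l, S) ∈ minimalForms) ∨ ∃ w, ValidWord w ∧ actWord w (x ^^^ l) < x ^^^ l := by
  induction t generalizing x l with
  | nil =>
    left
    cases hl with
    | zero =>
      simp only [reduces, List.any_eq_true, beq_iff_eq] at hr
      obtain ⟨⟨_, S⟩, hS, rfl⟩ := hr
      exact ⟨S, by simpa using hS⟩
    | step hk _ => simp at hk
  | cons s t ih =>
    simp only [separated, Bool.and_eq_true, List.all_eq_true, decide_eq_true_eq] at hs
    obtain ⟨⟨hv, hsep⟩, hs⟩ := hs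
    simp only [reduces, Bool.and_eq_true, Bool.or_eq_true, List.any_eq_true, Nat.blt_eq] at hr
    have main : ∀ y m, XorSpan (t.map Prod.fst) m →
        ((∃ w ∈ s.2.2, actWord w y >>> s.2.1 < y >>> s.2.1) ∨ reduces t y = true) →
        (∃ S, (y ^^^ m, S) ∈ minimalForms) ∨
          ∃ w, ValidWord w ∧ actWord w (y ^^^ m) < y ^^^ m := by
      rintro y m hm (⟨w, hw, hlt⟩ | hy)
      · refine .inr ⟨w, hv w hw, actWord_lt ?_ ?_ hlt hm⟩ <;>
        · simp only [List.forall_mem_map]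
          intro e he
          have := hsep e he
          first | exact this.1 | exact this.2 w hw
      · exact ih hs hy hm
    rcases XorSpan.cons hl with hl | ⟨l', hl', rfl⟩
    · exact main x l hl hr.1
    · rw [← Nat.xor_assoc]
      exact main _ l' hl' hr.2

lemma separated_stages : separated stages := by decide +kernel

lemma reduces_stages : reduces stages 0 := by decide +kernel

lemma certifies_minimalForms : ∀ e ∈ minimalForms, certifies e.1 e.2 := by decide +kernel

lemma map_fst_stages : stages.map Prod.fst = quarticCodes := by decide +kernel

lemma near_of_mem_minimalForms {e : ℕ × List ℕ} (he : e ∈ minimalForms) : Near e.1 :=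
  near_of_certifies (certifies_minimalForms e he)

lemma near_of_xorSpan {T : ℕ} (hT : XorSpan quarticCodes T) : Near T := by
  induction T using Nat.strong_induction_on with
  | _ T ih =>
    have h := minimal_or_actWord_lt (l := T) separated_stages reduces_stages
      (by rwa [map_fst_stages])
    rw [Nat.zero_xor] at h
    obtain ⟨S, hS⟩ | ⟨w, hw, hlt⟩ := h
    · exact near_of_mem_minimalForms (e := (T, S)) hS
    · exact near_of_near_actWord hw hT fun h => ih _ hlt h

lemma exists_quartic {f : BF 7} (hf : f ∈ RM 7 4) :
    ∃ T, XorSpan quarticCodes T ∧ f + quartic T ∈ RM 7 3 := by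
  have codes : ∀ A : Finset (Fin 7), A.card = 4 → ∃ k ∈ quarticCodes, supp k = A := by
    decide +kernel
  induction hf using Submodule.span_induction with
  | mem f hf =>
    obtain ⟨A, hA, rfl⟩ := hf
    rcases Nat.lt_or_ge A.card 4 with h | h
    · refine ⟨0, .zero, ?_⟩
      rw [quartic_zero, add_zero]
      exact mono_mem_RM (Nat.le_of_lt_succ h)
    · obtain ⟨k, hk, rfl⟩ := codes A (le_antisymm hA h)
      refine ⟨2 ^ k, .two_pow hk, ?_⟩
      rw [quartic_two_pow hk, bf_add_self]
      exact Submodule.zero_mem _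
  | zero => exact ⟨0, .zero, by rw [quartic_zero, add_zero]; exact Submodule.zero_mem _⟩
  | add f g _ _ hf hg =>
    obtain ⟨a, ha, hfa⟩ := hf
    obtain ⟨b, hb, hgb⟩ := hg
    refine ⟨a ^^^ b, ha.xor hb, ?_⟩
    rw [quartic_xor, add_add_add_comm]
    exact Submodule.add_mem _ hfa hgb
  | smul c f _ hf =>
    obtain rfl | rfl : c = 0 ∨ c = 1 := by revert c; decide
    · exact ⟨0, .zero, by rw [quartic_zero, zero_smul, add_zero]; exact Submodule.zero_mem _⟩
    · rwa [one_smul]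

lemma distRM_le {m r n : ℕ} {f : BF m} (h : ∃ p ∈ RM m r, wt (f + p) ≤ n) : distRM m r f ≤ n := by
  obtain ⟨p, hp, hw⟩ := h
  refine (Nat.sInf_le ?_).trans hw
  exact ⟨p, (deg_le_iff_mem_RM p).2 hp, rfl⟩

lemma distRM_quartic_le {f : BF 7} (hf : deg f ≤ 4) : distRM 7 3 f ≤ 20 := by
  obtain ⟨T, hT, hfT⟩ := exists_quartic ((deg_le_iff_mem_RM f).1 hf)
  obtain ⟨p, hp, hw⟩ := near_of_xorSpan hT
  refine distRM_le ⟨f + quartic T + p, Submodule.add_mem _ hfT hp, ?_⟩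
  rwa [← add_assoc, ← add_assoc, bf_add_self, zero_add]

lemma mono_insert {m : ℕ} (i : Fin m) (A : Finset (Fin m)) (v : Fin m → ZMod 2) :
    mono (insert i A) v = v i * mono A v := by
  have idem : ∀ c : ZMod 2, c * c = c := by decide
  by_cases h : i ∈ A
  · rw [Finset.insert_eq_of_mem h, mono, ← Finset.mul_prod_erase A v h, ← mul_assoc, idem]
  · exact Finset.prod_insert h

lemma mono_singleton {m : ℕ} (i : Fin m) (v : Fin m → ZMod 2) : mono {i} v = v i :=
  Finset.prod_singleton _ _

lemma mono_mul_mono {m : ℕ} (A B : Finset (Fin m)) (v : Fin m → ZMod 2) :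
    mono A v * mono B v = mono (A ∪ B) v := by
  induction A using Finset.induction_on with
  | empty => simp [mono]
  | insert i A _ ih => rw [Finset.insert_union, mono_insert, mono_insert, mul_assoc, ih]

lemma sum_mono {m : ℕ} (A : Finset (Fin m)) :
    ∑ v, mono A v = if A = Finset.univ then 1 else 0 := by
  have expand : ∀ v : Fin m → ZMod 2, mono A v = ∏ i, if i ∈ A then v i else 1 := by
    intro v
    rw [Finset.prod_ite_mem, Finset.univ_inter, mono]
  have factor : ∀ i : Fin m, (∑ c : ZMod 2, if i ∈ A then c else 1) = if i ∈ A then 1 else 0 := by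
    intro i
    by_cases h : i ∈ A <;> simp only [h, if_true, if_false] <;> decide
  simp only [expand]
  rw [← Fintype.piFinset_univ, Finset.sum_prod_piFinset (R := ZMod 2) Finset.univ
    (fun i c => if i ∈ A then c else 1)]
  simp only [factor, Finset.prod_ite_zero, Finset.prod_const_one, Finset.eq_univ_iff_forall,
    Finset.mem_univ, true_imp_iff]

lemma sum_mul_mono_eq_zero {m r : ℕ} {p : BF m} (hp : p ∈ RM m r) {B : Finset (Fin m)}
    (hB : r + B.card < m) : ∑ v, p v * mono B v = 0 := by
  induction hp using Submodule.span_induction with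
  | mem p hp =>
    obtain ⟨A, hA, rfl⟩ := hp
    simp only [mono_mul_mono, sum_mono]
    refine if_neg fun h => ?_
    have h1 := Finset.card_union_le A B
    rw [h, Finset.card_univ, Fintype.card_fin] at h1
    have : A.card ≤ r := hA
    lia
  | zero => simp
  | add p q _ _ hp hq => simp [add_mul, Finset.sum_add_distrib, hp, hq]
  | smul c p _ hp => simp [mul_assoc, ← Finset.mul_sum, hp]

/-- The codes of the monomials of a quartic form at distance `20` from the cubics. -/
def witnessCodes : Finset ℕ := {51, 46, 29, 105, 77, 71}

/-- A quartic form at distance `20` from the cubics. -/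
def witness : BF 7 := ∑ k ∈ witnessCodes, mono (supp k)

lemma witness_mem_RM : witness ∈ RM 7 4 := by
  have card_le : ∀ k ∈ witnessCodes, (supp k).card ≤ 4 := by decide +kernel
  exact Submodule.sum_mem _ fun k hk => mono_mem_RM (card_le k hk)

/-- The sum over all points of the product of `witness` and the monomial of `B`. -/
def moment (B : Finset (Fin 7)) : ZMod 2 :=
  ∑ k ∈ witnessCodes, if supp k ∪ B = Finset.univ then 1 else 0

lemma moment_eq_zero : ∀ B : Finset (Fin 7), B.card ≤ 2 → moment B = 0 := by decide +kernel

/-- The points at which `f` takes the value `1`. -/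
def pts {m : ℕ} (f : BF m) : Finset (Fin m → ZMod 2) := Finset.univ.filter fun v => f v = 1

lemma sum_pts {m : ℕ} (f h : BF m) : ∑ v ∈ pts f, h v = ∑ v, f v * h v := by
  have key : ∀ a b : ZMod 2, a * b = if a = 1 then b else 0 := by decide
  simp only [pts, Finset.sum_filter, key]

lemma sum_pts_witness_add {p : BF 7} (hp : p ∈ RM 7 3) {B : Finset (Fin 7)} (hB : B.card ≤ 3) :
    ∑ v ∈ pts (witness + p), mono B v = moment B := by
  rw [sum_pts]
  simp only [Pi.add_apply, add_mul, Finset.sum_add_distrib]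
  rw [sum_mul_mono_eq_zero hp (by lia), add_zero]
  simp only [witness, Finset.sum_apply, Finset.sum_mul, mono_mul_mono]
  rw [Finset.sum_comm]
  simp only [sum_mono, moment]

/-- The alternating bilinear map attached to the cubic moments of `witness`. -/
def cross {R : Type*} [Add R] [Mul R] (a u : Fin 7 → R) : Fin 7 → R :=
  ![a 4 * u 6 + a 6 * u 4,
    a 5 * u 6 + a 6 * u 5 + (a 2 * u 4 + a 4 * u 2) + (a 4 * u 5 + a 5 * u 4),
    a 3 * u 6 + a 6 * u 3 + (a 1 * u 4 + a 4 * u 1),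
    a 2 * u 6 + a 6 * u 2 + (a 4 * u 5 + a 5 * u 4),
    a 0 * u 6 + a 6 * u 0 + (a 1 * u 2 + a 2 * u 1) + (a 1 * u 5 + a 5 * u 1) +
      (a 3 * u 5 + a 5 * u 3),
    a 1 * u 6 + a 6 * u 1 + (a 1 * u 4 + a 4 * u 1) + (a 3 * u 4 + a 4 * u 3),
    a 2 * u 3 + a 3 * u 2 + (a 0 * u 4 + a 4 * u 0) + (a 1 * u 5 + a 5 * u 1)]

lemma sum_moment_eq_cross (a u : Fin 7 → ZMod 2) (i : Fin 7) :
    ∑ l, ∑ j, a l * u j * moment {l, j, i} = cross a u i := by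
  have h0 : ∀ l j : Fin 7, moment {l, j, 0} = if (l, j) ∈ [(4, 6), (6, 4)] then 1 else 0 := by
    decide +kernel
  have h1 : ∀ l j : Fin 7, moment {l, j, 1} =
      if (l, j) ∈ [(5, 6), (6, 5), (2, 4), (4, 2), (4, 5), (5, 4)] then 1 else 0 := by
    decide +kernel
  have h2 : ∀ l j : Fin 7, moment {l, j, 2} =
      if (l, j) ∈ [(3, 6), (6, 3), (1, 4), (4, 1)] then 1 else 0 := by decide +kernel
  have h3 : ∀ l j : Fin 7, moment {l, j, 3} =
      if (l, j) ∈ [(2, 6), (6, 2), (4, 5), (5, 4)] then 1 else 0 := by decide +kernel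
  have h4 : ∀ l j : Fin 7, moment {l, j, 4} =
      if (l, j) ∈ [(0, 6), (6, 0), (1, 2), (2, 1), (1, 5), (5, 1), (3, 5), (5, 3)] then 1 else 0 := by
    decide +kernel
  have h5 : ∀ l j : Fin 7, moment {l, j, 5} =
      if (l, j) ∈ [(1, 6), (6, 1), (1, 4), (4, 1), (3, 4), (4, 3)] then 1 else 0 := by
    decide +kernel
  have h6 : ∀ l j : Fin 7, moment {l, j, 6} =
      if (l, j) ∈ [(2, 3), (3, 2), (0, 4), (4, 0), (1, 5), (5, 1)] then 1 else 0 := by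
    decide +kernel
  fin_cases i <;>
    simp [h0, h1, h2, h3, h4, h5, h6, Fin.sum_univ_seven, cross] <;> ring

/-- The points of `S` on the hyperplane `a ⬝ᵥ v = c`. -/
def slice {m : ℕ} (S : Finset (Fin m → ZMod 2)) (a : Fin m → ZMod 2) (c : ZMod 2) :
    Finset (Fin m → ZMod 2) := S.filter fun v => a ⬝ᵥ v = c

lemma sum_slice {m : ℕ} (S : Finset (Fin m → ZMod 2)) (a : Fin m → ZMod 2) (c : ZMod 2)
    (h : BF m) :
    ∑ v ∈ slice S a c, h v = ∑ l, a l * ∑ v ∈ S, v l * h v + (c + 1) * ∑ v ∈ S, h v := by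
  have key : ∀ x c b : ZMod 2, (if x = c then b else 0) = x * b + (c + 1) * b := by decide
  simp only [slice, Finset.sum_filter, key, Finset.sum_add_distrib, ← Finset.mul_sum]
  congr 1
  simp only [dotProduct, Finset.sum_mul, Finset.mul_sum]
  rw [Finset.sum_comm]
  simp only [mul_assoc]

lemma sum_slice_witness {p : BF 7} (hp : p ∈ RM 7 3) (a : Fin 7 → ZMod 2) (c : ZMod 2) :
    ∑ _v ∈ slice (pts (witness + p)) a c, (1 : ZMod 2) = 0 ∧
    (∀ i, ∑ v ∈ slice (pts (witness + p)) a c, v i = 0) ∧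
    ∀ u i, ∑ v ∈ slice (pts (witness + p)) a c, (u ⬝ᵥ v) * v i = cross a u i := by
  set S := pts (witness + p)
  have s0 : ∑ _v ∈ S, (1 : ZMod 2) = 0 := by
    have := sum_pts_witness_add hp (B := ∅) (by simp)
    rw [moment_eq_zero _ (by simp)] at this
    simpa [mono] using this
  have s1 : ∀ i, ∑ v ∈ S, v i = 0 := by
    intro i
    have := sum_pts_witness_add hp (B := {i}) (by simp)
    rw [moment_eq_zero _ (by simp)] at this
    simpa only [mono_singleton] using this
  have s2 : ∀ i j, ∑ v ∈ S, v i * v j = 0 := by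
    intro i j
    have := sum_pts_witness_add hp (B := {i, j}) (Finset.card_le_two.trans (by norm_num))
    simpa only [moment_eq_zero _ Finset.card_le_two, mono_insert, mono_singleton] using this
  have s3 : ∀ l i j, ∑ v ∈ S, v l * (v i * v j) = moment {l, i, j} := by
    intro l i j
    have := sum_pts_witness_add hp (B := {l, i, j}) Finset.card_le_three
    simpa only [mono_insert, mono_singleton] using this
  refine ⟨?_, fun i => ?_, fun u i => ?_⟩
  · rw [sum_slice S a c fun _ => 1]
    simp only [mul_one, s0, s1, mul_zero, Finset.sum_const_zero, add_zero]
  · rw [sum_slice S a c fun v => v i]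
    simp only [s1, s2, mul_zero, Finset.sum_const_zero, add_zero]
  · have hij : ∀ j, ∑ v ∈ slice S a c, v j * v i = ∑ l, a l * moment {l, j, i} := by
      intro j
      rw [sum_slice S a c fun v => v j * v i]
      simp only [s2, s3, mul_zero, add_zero]
    have expand : ∀ v : Fin 7 → ZMod 2, (u ⬝ᵥ v) * v i = ∑ j, u j * (v j * v i) := by
      intro v
      simp only [dotProduct, Finset.sum_mul, mul_assoc]
    simp only [expand]
    rw [← sum_moment_eq_cross, Finset.sum_comm]
    conv_rhs => rw [Finset.sum_comm]
    refine Finset.sum_congr rfl fun j _ => ?_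
    rw [← Finset.mul_sum, hij, Finset.mul_sum]
    refine Finset.sum_congr rfl fun l _ => ?_
    ring

lemma card_le_card_ker_mul {m : ℕ} {S : Finset (Fin m → ZMod 2)}
    (h0 : ∑ _v ∈ S, (1 : ZMod 2) = 0) (h1 : ∀ i, ∑ v ∈ S, v i = 0) (hS : S.Nonempty) :
    2 ^ m ≤ (Finset.univ.filter fun u : Fin m → ZMod 2 =>
      ∀ i, ∑ v ∈ S, (u ⬝ᵥ v) * v i = 0).card * 2 ^ (S.card - 2) := by
  set K := Finset.univ.filter fun u : Fin m → ZMod 2 => ∀ i, ∑ v ∈ S, (u ⬝ᵥ v) * v i = 0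
  have h1' : ∑ v ∈ S, v = 0 := by
    funext i
    rw [Finset.sum_apply]
    exact h1 i
  obtain ⟨x₀, hx₀⟩ := hS
  obtain ⟨x₁, hx₁, hne⟩ : ∃ x₁ ∈ S, x₁ ≠ x₀ := by
    by_contra! h
    rw [Finset.eq_singleton_iff_unique_mem.2 ⟨hx₀, h⟩] at h0
    simp at h0
  set R := (S.erase x₀).erase x₁
  have hR : R.card = S.card - 2 := by
    rw [Finset.card_erase_of_mem (Finset.mem_erase.2 ⟨hne, hx₁⟩), Finset.card_erase_of_mem hx₀]
    lia
  have ker : ∀ w : Fin m → ZMod 2, (∀ r ∈ R, w ⬝ᵥ (r + x₀) = 0) → w ∈ K := by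
    intro w hw
    have hsum : ∑ v ∈ S, w ⬝ᵥ (v + x₀) = 0 := by
      have hc : ∑ _v ∈ S, w ⬝ᵥ x₀ = 0 := by
        rw [← mul_one (w ⬝ᵥ x₀), ← Finset.mul_sum, h0, mul_zero]
      simp only [dotProduct_add, Finset.sum_add_distrib]
      rw [hc, ← dotProduct_sum, h1', dotProduct_zero, add_zero]
    have other : ∀ v ∈ S, v ≠ x₁ → w ⬝ᵥ (v + x₀) = 0 := by
      intro v hv hv1
      by_cases hv0 : v = x₀
      · rw [hv0, dotProduct_add, CharTwo.add_self_eq_zero]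
      · exact hw v (Finset.mem_erase.2 ⟨hv1, Finset.mem_erase.2 ⟨hv0, hv⟩⟩)
    have all : ∀ v ∈ S, w ⬝ᵥ v = w ⬝ᵥ x₀ := by
      intro v hv
      have : w ⬝ᵥ (v + x₀) = 0 := by
        by_cases hv1 : v = x₁
        · rw [Finset.sum_eq_single_of_mem x₁ hx₁ other] at hsum
          rwa [hv1]
        · exact other v hv hv1
      rwa [dotProduct_add, CharTwo.add_eq_zero] at this
    refine Finset.mem_filter.2 ⟨Finset.mem_univ _, fun i => ?_⟩
    rw [Finset.sum_congr rfl fun v hv => by rw [all v hv], ← Finset.mul_sum, h1, mul_zero]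
  let L : (Fin m → ZMod 2) → R → ZMod 2 := fun u r => u ⬝ᵥ (r.1 + x₀)
  have fiber : ∀ b ∈ Finset.univ.image L,
      (Finset.univ.filter fun u => L u = b).card ≤ K.card := by
    intro b hb
    obtain ⟨u₀, -, rfl⟩ := Finset.mem_image.1 hb
    refine Finset.card_le_card_of_injOn (· + u₀) (fun u hu => ?_)
      (fun a _ b _ h => add_right_cancel h)
    refine ker _ fun r hr => ?_
    have := congrFun (Finset.mem_filter.1 hu).2 ⟨r, hr⟩
    rw [add_dotProduct, CharTwo.add_eq_zero]
    exact this
  have total := Finset.card_le_mul_card_image Finset.univ K.card fiber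
  rw [Finset.card_univ, Fintype.card_pi_const, ZMod.card] at total
  refine total.trans (Nat.mul_le_mul_left _ ((Finset.card_le_univ _).trans_eq ?_))
  rw [Fintype.card_fun, ZMod.card, Fintype.card_coe, hR]

/-- The number of points orthogonal to `a` under the alternating bilinear map `cross`. -/
def kerCard (a : Fin 7 → ZMod 2) : ℕ := (Finset.univ.filter fun u => ∀ i, cross a u i = 0).card

/-- A lower bound for the size of a set of points with the moments of a slice, in terms of the
size of the kernel of its matrix of second moments. -/
def sliceBound (n : ℕ) : ℕ := if n ≤ 2 then 8 else if n ≤ 8 then 6 else if n ≤ 32 then 4 else 0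

lemma even_card_of_sum {α : Type*} {S : Finset α} (h : ∑ _v ∈ S, (1 : ZMod 2) = 0) :
    Even S.card := by
  rw [Finset.sum_const, nsmul_one] at h
  exact ZMod.natCast_eq_zero_iff_even.1 h

lemma sliceBound_le_card_slice {p : BF 7} (hp : p ∈ RM 7 3) (a : Fin 7 → ZMod 2) (c : ZMod 2) :
    sliceBound (kerCard a) ≤ (slice (pts (witness + p)) a c).card := by
  obtain ⟨h0, h1, h2⟩ := sum_slice_witness hp a c
  set S := slice (pts (witness + p)) a c
  rcases S.eq_empty_or_nonempty with hS | hS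
  · have hk : kerCard a = 128 := by
      have : ∀ u i, cross a u i = 0 := fun u i => by rw [← h2, hS, Finset.sum_empty]
      simp [kerCard, this]
    simp [hk, sliceBound]
  · have key := card_le_card_ker_mul h0 h1 hS
    simp only [h2] at key
    change 2 ^ 7 ≤ kerCard a * 2 ^ (S.card - 2) at key
    have bound : ∀ n k, kerCard a ≤ k → k * 2 ^ n < 2 ^ 7 → n < S.card - 2 := by
      intro n k hk hn
      by_contra! h
      have := Nat.mul_le_mul hk (Nat.pow_le_pow_right (n := 2) (by norm_num) h)
      lia
    obtain ⟨n, hn⟩ := even_card_of_sum h0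
    unfold sliceBound
    split_ifs with ha hb hc
    · have := bound 5 2 ha (by norm_num)
      lia
    · have := bound 3 8 hb (by norm_num)
      lia
    · have := bound 1 32 hc (by norm_num)
      lia
    · exact Nat.zero_le _

/-- A sequence of natural numbers whose parities are the binary digits of `c`. -/
def digits (c : ℕ) (i : Fin 7) : ℕ := c >>> (i : ℕ)

lemma cross_digits (c d : ℕ) (i : Fin 7) :
    ((cross (digits c) (digits d) i : ℕ) : ZMod 2) = cross (point c) (point d) i := by
  have hd : ∀ c (i : Fin 7), ((digits c i : ℕ) : ZMod 2) = point c i := by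
    intro c i
    have ht : i ∈ supp c ↔ (c >>> (i : ℕ)) % 2 = 1 := by
      simp [supp, Nat.testBit_eq_decide_div_mod_eq, Nat.shiftRight_eq_div_pow]
    simp only [digits, point, ht]
    rcases Nat.mod_two_eq_zero_or_one (c >>> (i : ℕ)) with h | h
    · rw [if_neg (by lia)]
      exact (ZMod.natCast_eq_zero_iff _ 2).2 (Nat.dvd_of_mod_eq_zero h)
    · rw [if_pos h, ← ZMod.natCast_mod, h, Nat.cast_one]
  fin_cases i <;> simp [cross, hd]

lemma sum_point {M : Type*} [AddCommMonoid M] (F : (Fin 7 → ZMod 2) → M) :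
    ∑ v, F v = ∑ c ∈ Finset.range 128, F (point c) := by
  let e : (Fin 7 → ZMod 2) → Finset (Fin 7) := fun v => Finset.univ.filter fun i => v i = 1
  have he : ∀ A : Finset (Fin 7), e (fun i => if i ∈ A then 1 else 0) = A := by
    intro A
    ext i
    simp [e]
  have hp : ∀ v, (fun i => if i ∈ e v then 1 else 0) = v := by
    intro v
    have key : ∀ x : ZMod 2, (if x = 1 then 1 else 0) = x := by decide
    funext i
    simp [e, key]
  have := sum_supp fun A => F fun i => if i ∈ A then 1 else 0
  rw [show (fun c => F (point c)) = fun c => F fun i => if i ∈ supp c then 1 else 0 from rfl,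
    ← this]
  exact Fintype.sum_equiv ⟨e, fun A i => if i ∈ A then 1 else 0, hp, he⟩ _ _ fun v => by
    rw [Equiv.coe_fn_mk, hp]

/-- The size of the kernel attached to the point with code `c`, computed with codes. -/
def kerCount (c : ℕ) : ℕ :=
  (List.range 128).countP fun d =>
    (List.finRange 7).all fun i => (cross (digits c) (digits d) i % 2).beq 0

lemma kerCard_point (c : ℕ) : kerCard (point c) = kerCount c := by
  have key : ∀ d, (∀ i, cross (point c) (point d) i = 0) ↔
      ((List.finRange 7).all fun i => (cross (digits c) (digits d) i % 2).beq 0) = true := by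
    intro d
    simp [← cross_digits, ZMod.natCast_eq_zero_iff, Nat.dvd_iff_mod_eq_zero]
  rw [kerCard, Finset.card_filter, sum_point, ← Finset.card_filter, kerCount,
    List.countP_eq_length_filter]
  simp only [key]
  rw [← List.toFinset_range, ← List.toFinset_filter,
    List.toFinset_card_of_nodup (List.nodup_range.filter _)]

lemma sliceBound_kerCount :
    ((List.range 128).map fun c => sliceBound (kerCount c)).sum = 952 ∧
    ((List.range 128).map fun c => sliceBound (kerCount c) ^ 2).sum = 7240 ∧
    ∃ c < 128, sliceBound (kerCount c) = 8 := by
  decide +kernel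

lemma sum_sliceBound : ∑ a, sliceBound (kerCard a) = 952 := by
  rw [sum_point, ← sliceBound_kerCount.1, ← List.sum_toFinset _ List.nodup_range]
  simp only [kerCard_point, List.toFinset_range]

lemma sum_sliceBound_sq : ∑ a, sliceBound (kerCard a) ^ 2 = 7240 := by
  rw [sum_point, ← sliceBound_kerCount.2.1, ← List.sum_toFinset _ List.nodup_range]
  simp only [kerCard_point, List.toFinset_range]

lemma card_dotProduct_eq_one {m : ℕ} {z : Fin (m + 1) → ZMod 2} (hz : z ≠ 0) :
    (Finset.univ.filter fun a => a ⬝ᵥ z = 1).card = 2 ^ m := by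
  obtain ⟨i, hi⟩ : ∃ i, z i = 1 := by
    by_contra! h
    refine hz (funext fun i => ?_)
    have key : ∀ x : ZMod 2, x ≠ 1 → x = 0 := by decide
    exact key _ (h i)
  have hflip : (Finset.univ.filter fun a => a ⬝ᵥ z = 1).card =
      (Finset.univ.filter fun a => ¬ a ⬝ᵥ z = 1).card := by
    refine Finset.card_equiv (Equiv.addRight (Pi.single i 1)) fun a => ?_
    have key : ∀ x : ZMod 2, x = 1 ↔ ¬ x + 1 = 1 := by decide
    simp [add_dotProduct, hi, key (a ⬝ᵥ z)]
  have total := Finset.card_filter_add_card_filter_not (s := Finset.univ)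
    (fun a : Fin (m + 1) → ZMod 2 => a ⬝ᵥ z = 1)
  rw [← hflip, Finset.card_univ, Fintype.card_pi_const, ZMod.card, pow_succ] at total
  lia

lemma card_slice_add {m : ℕ} (S : Finset (Fin m → ZMod 2)) (a : Fin m → ZMod 2) :
    (slice S a 0).card + (slice S a 1).card = S.card := by
  have key : ∀ x : ZMod 2, x = 1 ↔ ¬ x = 0 := by decide
  simp only [slice, key]
  exact Finset.card_filter_add_card_filter_not _

lemma sum_card_slice_mul {m : ℕ} (S : Finset (Fin (m + 1) → ZMod 2)) :
    2 * ∑ a, (slice S a 0).card * (slice S a 1).card = 2 ^ m * (S.card * (S.card - 1)) := by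
  have separate : ∀ a : Fin (m + 1) → ZMod 2,
      2 * ((slice S a 0).card * (slice S a 1).card) =
        ∑ x ∈ S, ∑ y ∈ S, if a ⬝ᵥ (x + y) = 1 then 1 else 0 := by
    intro a
    have inner : ∀ x ∈ S, (∑ y ∈ S, if a ⬝ᵥ (x + y) = 1 then 1 else 0) =
        if a ⬝ᵥ x = 0 then (slice S a 1).card else (slice S a 0).card := by
      intro x _
      have key : ∀ s t : ZMod 2, s + t = 1 ↔ if s = 0 then t = 1 else t = 0 := by decide
      rw [← Finset.card_filter]
      simp only [dotProduct_add, key]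
      split_ifs <;> rfl
    have key : ∀ x : ZMod 2, ¬ x = 0 ↔ x = 1 := by decide
    rw [Finset.sum_congr rfl inner, Finset.sum_ite, Finset.sum_const, Finset.sum_const]
    simp only [key, smul_eq_mul]
    change _ = (slice S a 0).card * _ + (slice S a 1).card * _
    ring
  have pair : ∀ x y : Fin (m + 1) → ZMod 2,
      (∑ a : Fin (m + 1) → ZMod 2, if a ⬝ᵥ (x + y) = 1 then 1 else 0) =
        if x = y then 0 else 2 ^ m := by
    intro x y
    rw [← Finset.card_filter]
    have hxy : x + y = 0 ↔ x = y := by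
      simp only [funext_iff, Pi.add_apply, Pi.zero_apply, CharTwo.add_eq_zero]
    split_ifs with h
    · rw [hxy.2 h]
      simp
    · exact card_dotProduct_eq_one (mt hxy.1 h)
  rw [Finset.mul_sum, Finset.sum_congr rfl fun a _ => separate a, Finset.sum_comm]
  have row : ∀ x ∈ S, (∑ a : Fin (m + 1) → ZMod 2, ∑ y ∈ S,
      if a ⬝ᵥ (x + y) = 1 then 1 else 0) = 2 ^ m * (S.card - 1) := by
    intro x hx
    rw [Finset.sum_comm, Finset.sum_congr rfl fun y _ => pair x y, ← Finset.add_sum_erase S _ hx,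
      if_pos rfl, zero_add, Finset.sum_congr rfl fun y hy => if_neg (Finset.ne_of_mem_erase hy).symm,
      Finset.sum_const, Finset.card_erase_of_mem hx, smul_eq_mul, mul_comm]
  rw [Finset.sum_congr rfl row, Finset.sum_const, smul_eq_mul]
  ring

lemma twenty_le_wt_witness_add {p : BF 7} (hp : p ∈ RM 7 3) : 20 ≤ wt (witness + p) := by
  change 20 ≤ (pts (witness + p)).card
  set S := pts (witness + p) with hS
  have low := sliceBound_le_card_slice hp
  rw [← hS] at low
  have even : Even S.card := by
    have hempty := sum_pts_witness_add hp (B := ∅) (by simp)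
    rw [moment_eq_zero _ (by simp)] at hempty
    exact even_card_of_sum (by simpa [mono] using hempty)
  have ge16 : 16 ≤ S.card := by
    obtain ⟨c, -, hc⟩ := sliceBound_kerCount.2.2
    rw [← kerCard_point] at hc
    have h0 := low (point c) 0
    have h1 := low (point c) 1
    rw [hc] at h0 h1
    rw [← card_slice_add S (point c)]
    lia
  have count : 2 * ∑ a, (slice S a 0).card * (slice S a 1).card =
      2 ^ 6 * (S.card * (S.card - 1)) := sum_card_slice_mul S
  have term : ∀ a, sliceBound (kerCard a) * S.card ≤
      (slice S a 0).card * (slice S a 1).card + sliceBound (kerCard a) ^ 2 := by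
    intro a
    obtain ⟨s, hs⟩ := Nat.exists_eq_add_of_le (low a 0)
    obtain ⟨t, ht⟩ := Nat.exists_eq_add_of_le (low a 1)
    rw [← card_slice_add S a, hs, ht]
    nlinarith [Nat.zero_le (s * t)]
  have sum_le := Finset.sum_le_sum fun a (_ : a ∈ Finset.univ) => term a
  rw [← Finset.sum_mul, Finset.sum_add_distrib, sum_sliceBound, sum_sliceBound_sq] at sum_le
  by_contra! h
  obtain ⟨n, hn⟩ := even
  obtain h | h : S.card = 16 ∨ S.card = 18 := by lia
  all_goals
    rw [h] at sum_le count
    lia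

/-- The covering radius of `RM(3,7)` in `RM(4,7)` equals 20. -/
theorem stmt11 :
    (∀ f : BF 7, deg f ≤ 4 → distRM 7 3 f ≤ 20) ∧
      (∃ f : BF 7, deg f ≤ 4 ∧ distRM 7 3 f = 20) := by
  have hw : deg witness ≤ 4 := (deg_le_iff_mem_RM _).2 witness_mem_RM
  refine ⟨fun f hf => distRM_quartic_le hf, witness, hw, le_antisymm (distRM_quartic_le hw) ?_⟩
  refine le_csInf ⟨_, 0, (deg_le_iff_mem_RM 0).2 (Submodule.zero_mem _), rfl⟩ ?_
  rintro _ ⟨p, hp, rfl⟩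
  exact twenty_le_wt_witness_add ((deg_le_iff_mem_RM p).1 hp)
end
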